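/- arXiv:1808.05940 — 2 statements merged into one kernel-verified Lean document; each statement's English description precedes it below -/
import Mathlib

section
/- If G ∈ F, κ(G) = 2, and S is any 2-cut of G, then the augmented component C⁺ of every component C of G − S is non-planar. -/
open SimpleGraph

/-- The complete graph on five vertices. -/
def K5 : SimpleGraph (Fin 5) := ⊤

/-- The complete bipartite graph `K_{3,3}`. -/
def K33 : SimpleGraph (Fin 6) :=
  SimpleGraph.fromRel (fun i j => i.val < 3 ∧ 3 ≤ j.val)

/-- `K_{3,3}` plus one extra edge joining two vertices in the same part. -/
def K33e : SimpleGraph (Fin 6) :=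
  SimpleGraph.fromRel (fun i j => (i.val < 3 ∧ 3 ≤ j.val) ∨ (i.val = 0 ∧ j.val = 1))

/-- `H` is a minor of `G`, witnessed by a family of nonempty, connected,
pairwise disjoint branch sets together with edges between the branch sets of
adjacent vertices of `H`. -/
def SimpleGraph.IsMinorOf {W V : Type} (H : SimpleGraph W) (G : SimpleGraph V) : Prop :=
  ∃ f : W → Set V,
    (∀ w, (G.induce (f w)).Connected) ∧
    (Pairwise fun w w' => Disjoint (f w) (f w')) ∧
    (∀ ⦃w w'⦄, H.Adj w w' → ∃ u ∈ f w, ∃ v ∈ f w', G.Adj u v)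

/-- Planarity, via the Kuratowski–Wagner characterization: a (finite simple) graph is
planar iff it has no `K₅` minor and no `K_{3,3}` minor. -/
def IsPlanar {V : Type} (G : SimpleGraph V) : Prop :=
  ¬ K5.IsMinorOf G ∧ ¬ K33.IsMinorOf G

/-- A graph is apex if it is planar or some vertex deletion makes it planar. -/
def IsApex {V : Type} (G : SimpleGraph V) : Prop :=
  IsPlanar G ∨ ∃ v : V, IsPlanar (G.induce {u | u ≠ v})

/-- `G` is an obstruction for the apex family: it is not apex, but every minor of it
that is not isomorphic to it is apex. -/
def IsApexObstruction {V : Type} (G : SimpleGraph V) : Prop :=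
  ¬ IsApex G ∧
    ∀ (W : Type) (H : SimpleGraph W), H.IsMinorOf G → IsEmpty (H ≃g G) → IsApex H

/-- Subdivide the edge `uv` of `G`: the new vertex is `none`. -/
def subdivideEdge {V : Type} (G : SimpleGraph V) (u v : V) : SimpleGraph (Option V) :=
  SimpleGraph.fromRel (fun x y =>
    (∃ a b, x = some a ∧ y = some b ∧ G.Adj a b ∧ s(a, b) ≠ s(u, v)) ∨
    (x = none ∧ (y = some u ∨ y = some v)))

/-- `IsSubdivision G H` : `H` is (isomorphic to) a graph obtained from `G` by repeatedly
subdividing edges. -/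
inductive IsSubdivision : {V : Type} → SimpleGraph V → {W : Type} → SimpleGraph W → Prop
  | of_iso {V W : Type} {G : SimpleGraph V} {H : SimpleGraph W} :
      (G ≃g H) → IsSubdivision G H
  | step {V W U : Type} {G : SimpleGraph V} {H : SimpleGraph W} {u v : W}
      {H' : SimpleGraph U} :
      H.Adj u v → IsSubdivision G H → (subdivideEdge H u v ≃g H') → IsSubdivision G H'

/-- A Kuratowski subgraph of `G` is a subgraph that is a subdivision of `K₅` or `K_{3,3}`. -/
def IsKuratowski {V : Type} {G : SimpleGraph V} (H : G.Subgraph) : Prop :=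
  IsSubdivision K5 H.coe ∨ IsSubdivision K33 H.coe

/-- A Kuratowski witness for `v` is a Kuratowski subgraph of `G` avoiding `v`. -/
def IsKuratowskiWitness {V : Type} (G : SimpleGraph V) (v : V) (H : G.Subgraph) : Prop :=
  IsKuratowski H ∧ v ∉ H.verts

/-- A branch vertex of a (Kuratowski) subgraph: a vertex of degree at least 3 in it. -/
def IsBranchVertex {V : Type} {G : SimpleGraph V} (H : G.Subgraph) (x : V) : Prop :=
  x ∈ H.verts ∧ 3 ≤ (H.neighborSet x).ncard

/-- The vertex connectivity of a finite graph: the largest `k` such that deleting any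
fewer than `k` vertices leaves a connected graph. -/
noncomputable def vConn {V : Type} [Fintype V] (G : SimpleGraph V) : ℕ :=
  sSup {k : ℕ | ∀ s : Finset V, s.card < k → (G.induce ((↑s : Set V)ᶜ)).Connected}

/-- A 2-cut: a set of two vertices whose deletion disconnects the graph. -/
def IsTwoCut {V : Type} (G : SimpleGraph V) (S : Set V) : Prop :=
  S.ncard = 2 ∧ ¬ (G.induce Sᶜ).Preconnected

/-- `C` is (the vertex set of) a connected component of `G − S`. -/
def IsCompOf {V : Type} (G : SimpleGraph V) (S : Set V) (C : Set V) : Prop :=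
  C.Nonempty ∧ Disjoint C S ∧ (G.induce C).Connected ∧
    ∀ u ∈ C, ∀ v, v ∉ S → G.Adj u v → v ∈ C

/-- The augmented component `C⁺`: the subgraph induced by `C ∪ S` together with all
edges joining vertices of `S`. -/
def augment {V : Type} (G : SimpleGraph V) (S C : Set V) : SimpleGraph ↥(C ∪ S) :=
  SimpleGraph.fromRel (fun u v => G.Adj (u : V) (v : V) ∨ ((u : V) ∈ S ∧ (v : V) ∈ S))

/-- `C` is a heavy component for the 2-cut `{a,b}`: a component of `G − {a,b}` whose
augmentation contains Kuratowski witnesses for both `a` and `b`. -/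
def IsHeavyComp {V : Type} (G : SimpleGraph V) (a b : V) (C : Set V) : Prop :=
  IsCompOf G {a, b} C ∧
    (∃ Ha : G.Subgraph, IsKuratowskiWitness G a Ha ∧ Ha.verts ⊆ C ∪ {a, b}) ∧
    (∃ Hb : G.Subgraph, IsKuratowskiWitness G b Hb ∧ Hb.verts ⊆ C ∪ {a, b})

/-- `{a,b}` is a basic 2-cut with heavy component `C`: a 2-cut whose heavy-component
weight is minimum among all 2-cuts. -/
def IsBasic2Cut {V : Type} (G : SimpleGraph V) (a b : V) (C : Set V) : Prop :=
  IsTwoCut G {a, b} ∧ IsHeavyComp G a b C ∧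
    ∀ c d : V, ∀ D : Set V, IsTwoCut G {c, d} → IsHeavyComp G c d D → C.ncard ≤ D.ncard

/-- The subgraph of `G` induced by `A`, kept on the same vertex set (vertices outside `A`
become isolated). -/
def restrictTo {V : Type} (G : SimpleGraph V) (A : Set V) : SimpleGraph V :=
  SimpleGraph.fromRel (fun u v => G.Adj u v ∧ u ∈ A ∧ v ∈ A)

/-- Contract the edge `uv` of `G`, keeping the label `u` for the merged vertex
(`v` becomes isolated). -/
def contractEdge {V : Type} (G : SimpleGraph V) (u v : V) : SimpleGraph V :=
  SimpleGraph.fromRel (fun x y =>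
    x ≠ v ∧ y ≠ v ∧ (G.Adj x y ∨ (x = u ∧ G.Adj v y) ∨ (y = u ∧ G.Adj x v)))

/-- `T` separates `a` from `b` in `G`: `a, b ∉ T` and every walk from `a` to `b`
meets `T`. -/
def Separates {V : Type} (G : SimpleGraph V) (T : Set V) (a b : V) : Prop :=
  a ∉ T ∧ b ∉ T ∧ ∀ p : G.Walk a b, ∃ t ∈ T, t ∈ p.support

/-- Disjoint union of two graphs. -/
def disjUnion {V W : Type} (G : SimpleGraph V) (H : SimpleGraph W) : SimpleGraph (V ⊕ W) :=
  SimpleGraph.fromRel (fun x y =>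
    (∃ a b, x = Sum.inl a ∧ y = Sum.inl b ∧ G.Adj a b) ∨
    (∃ a b, x = Sum.inr a ∧ y = Sum.inr b ∧ H.Adj a b))

/-- The graph on `Fin n` with the given list of edges. -/
def graphOfList (n : ℕ) (l : List (ℕ × ℕ)) : SimpleGraph (Fin n) :=
  SimpleGraph.fromRel (fun i j => ((i : ℕ), (j : ℕ)) ∈ l)

/-- A graph is 2-connected: at least three vertices and no cut vertex. -/
def IsTwoConnectedGraph {U : Type} (H : SimpleGraph U) : Prop :=
  3 ≤ Nat.card U ∧ ∀ u : U, (H.induce {x | x ≠ u}).Connected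


namespace SimpleGraph

/-- `H` has a minor model in `G` all of whose branch sets lie in `U`. -/
def IsMinorWithin {W V : Type} (H : SimpleGraph W) (G : SimpleGraph V) (U : Set V) : Prop :=
  ∃ f : W → Set V,
    (∀ w, (G.induce (f w)).Connected) ∧
    (Pairwise fun w w' => Disjoint (f w) (f w')) ∧
    (∀ ⦃w w'⦄, H.Adj w w' → ∃ u ∈ f w, ∃ v ∈ f w', G.Adj u v) ∧
    ∀ w, f w ⊆ U

variable {W V : Type} {H : SimpleGraph W} {G : SimpleGraph V}

theorem IsMinorOf.isMinorWithin_univ (h : H.IsMinorOf G) : H.IsMinorWithin G Set.univ := by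
  obtain ⟨f, h₁, h₂, h₃⟩ := h
  exact ⟨f, h₁, h₂, h₃, fun _ => Set.subset_univ _⟩

theorem IsMinorWithin.isMinorOf {U : Set V} (h : H.IsMinorWithin G U) : H.IsMinorOf G := by
  obtain ⟨f, h₁, h₂, h₃, -⟩ := h
  exact ⟨f, h₁, h₂, h₃⟩

theorem IsMinorOf.isMinorWithin_of_induce {U : Set V} (h : H.IsMinorOf (G.induce U)) :
    H.IsMinorWithin G U := by
  obtain ⟨f, h₁, h₂, h₃⟩ := h
  refine ⟨fun w => Subtype.val '' f w, fun w => ?_, fun w w' hw => ?_, fun w w' hw => ?_, ?_⟩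
  · let φ : (G.induce U).induce (f w) →g G.induce (Subtype.val '' f w) :=
      { toFun := fun x => ⟨x.1.1, x.1, x.2, rfl⟩
        map_rel' := fun h => h }
    refine (h₁ w).map φ ?_
    rintro ⟨_, x, hx, rfl⟩
    exact ⟨⟨x, hx⟩, rfl⟩
  · exact (Set.disjoint_image_iff Subtype.val_injective).2 (h₂ hw)
  · obtain ⟨u, hu, v, hv, huv⟩ := h₃ hw
    exact ⟨u, ⟨u, hu, rfl⟩, v, ⟨v, hv, rfl⟩, huv⟩
  · rintro w _ ⟨x, -, rfl⟩
    exact x.2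

theorem IsMinorWithin.induce {U T : Set V} (h : H.IsMinorWithin G T) (hTU : T ⊆ U) :
    H.IsMinorWithin (G.induce U) (Subtype.val ⁻¹' T) := by
  obtain ⟨f, h₁, h₂, h₃, h₄⟩ := h
  refine ⟨fun w => Subtype.val ⁻¹' f w, fun w => ?_, fun w w' hw => ?_, fun w w' hw => ?_,
    fun w => Set.preimage_mono (h₄ w)⟩
  · let φ : G.induce (f w) →g (G.induce U).induce (Subtype.val ⁻¹' f w) :=
      { toFun := fun x => ⟨⟨x.1, hTU (h₄ w x.2)⟩, x.2⟩
        map_rel' := fun h => h }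
    exact (h₁ w).map φ fun x => ⟨⟨x.1.1, x.2⟩, rfl⟩
  · exact (h₂ hw).preimage _
  · obtain ⟨u, hu, v, hv, huv⟩ := h₃ hw
    exact ⟨⟨u, hTU (h₄ w hu)⟩, hu, ⟨v, hTU (h₄ w' hv)⟩, hv, huv⟩

/-- A property which propagates along the edges of a connected induced subgraph holds on all of
it as soon as it holds somewhere. -/
theorem Connected.forall_mem_of_adj {X : Set V} (hX : (G.induce X).Connected) {P : V → Prop}
    (hP : ∀ x ∈ X, ∀ y ∈ X, G.Adj x y → P x → P y) {u v : V} (hu : u ∈ X) (hv : v ∈ X)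
    (h : P u) : P v := by
  obtain ⟨p⟩ := hX.preconnected ⟨u, hu⟩ ⟨v, hv⟩
  suffices ∀ {x y : X}, (G.induce X).Walk x y → P x → P y from this p h
  intro x y q
  induction q with
  | nil => exact id
  | cons hxy _ ih => exact fun hx => ih (hP _ (Subtype.property _) _ (Subtype.property _) hxy hx)

/-- `G` together with all edges joining vertices of `S`. -/
def addClique (G : SimpleGraph V) (S : Set V) : SimpleGraph V :=
  SimpleGraph.fromRel (fun u v => G.Adj u v ∨ (u ∈ S ∧ v ∈ S))

theorem addClique_adj {S : Set V} {u v : V} :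
    (G.addClique S).Adj u v ↔ G.Adj u v ∨ (u ≠ v ∧ u ∈ S ∧ v ∈ S) := by
  have : G.Adj u v → u ≠ v := fun h => h.ne
  simp only [addClique, fromRel_adj, G.adj_comm v u]
  tauto

theorem induce_addClique (S C : Set V) : (G.addClique S).induce (C ∪ S) = augment G S C := by
  ext u v
  simp [augment, addClique, Subtype.ext_iff]

/-- Passing to one side `A` of a separation with separator `S`, once `S` is made complete,
preserves connectedness. -/
theorem Connected.inter_addClique {S A X : Set V}
    (hA : ∀ u ∈ A, ∀ v, v ∉ A → G.Adj u v → u ∈ S) (hX : (G.induce X).Connected)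
    (hne : (X ∩ A).Nonempty) : ((G.addClique S).induce (X ∩ A)).Connected := by
  have : Nonempty ↥(X ∩ A) := hne.to_subtype
  refine ⟨fun u v => ?_⟩
  let R := ((G.addClique S).induce (X ∩ A)).Reachable u
  suffices h : (∀ hv : v.1 ∈ X ∩ A, R ⟨v, hv⟩) from h v.2
  refine (hX.forall_mem_of_adj (u := u.1) (v := v.1)
    (P := fun x => (∀ hx : x ∈ X ∩ A, R ⟨x, hx⟩) ∧
      (x ∉ A → ∃ s, ∃ hs : s ∈ X ∩ A, s ∈ S ∧ R ⟨s, hs⟩)) ?_ u.2.1 v.2.1 ?_).1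
  · rintro x hx y hy hxy ⟨hin, hout⟩
    refine ⟨fun hyA => ?_, fun hyA => ?_⟩
    · by_cases hxA : x ∈ A
      · exact (hin ⟨hx, hxA⟩).trans (Adj.reachable (addClique_adj.2 (Or.inl hxy)))
      · obtain ⟨s, hs, hsS, hR⟩ := hout hxA
        by_cases hsy : s = y
        · subst hsy
          exact hR
        · exact hR.trans (Adj.reachable
            (addClique_adj.2 (Or.inr ⟨hsy, hsS, hA y hyA.2 x hxA hxy.symm⟩)))
    · by_cases hxA : x ∈ A
      · exact ⟨x, ⟨hx, hxA⟩, hA x hxA y hyA hxy, hin ⟨hx, hxA⟩⟩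
      · exact hout hxA
  · exact ⟨fun _ => Reachable.refl _, fun h => absurd u.2.2 h⟩

/-- If every branch set avoiding the separator `S` lies on the side `A`, then intersecting the
branch sets with `A` gives a minor model in the augmented side. -/
theorem isMinorWithin_addClique_of_side {S A U : Set V} (hSA : S ⊆ A)
    (hA : ∀ u ∈ A, ∀ v, v ∉ A → G.Adj u v → u ∈ S) {f : W → Set V}
    (hconn : ∀ w, (G.induce (f w)).Connected)
    (hdisj : Pairwise fun w w' => Disjoint (f w) (f w'))
    (hadj : ∀ ⦃w w'⦄, H.Adj w w' → ∃ u ∈ f w, ∃ v ∈ f w', G.Adj u v)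
    (hU : ∀ w, f w ⊆ U) (hside : ∀ w, f w ⊆ A ∨ (f w ∩ S).Nonempty) :
    H.IsMinorWithin (G.addClique S) (U ∩ A) := by
  refine ⟨fun w => f w ∩ A, fun w => (hconn w).inter_addClique hA ?_,
    fun w w' hw => (hdisj hw).mono Set.inter_subset_left Set.inter_subset_left,
    fun w w' hw => ?_, fun w => Set.inter_subset_inter_left _ (hU w)⟩
  · rcases hside w with h | h
    · obtain ⟨x⟩ := (hconn w).nonempty
      exact ⟨x, x.2, h x.2⟩
    · exact h.mono (Set.inter_subset_inter_right _ hSA)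
  · obtain ⟨u, hu, v, hv, huv⟩ := hadj hw
    by_cases hin : u ∈ A ∧ v ∈ A
    · exact ⟨u, ⟨hu, hin.1⟩, v, ⟨hv, hin.2⟩, addClique_adj.2 (Or.inl huv)⟩
    have meets : ∀ {w u}, u ∈ f w → (u ∈ A → u ∈ S) → (f w ∩ S).Nonempty := by
      intro w u hu h
      rcases hside w with h' | h'
      · exact ⟨u, hu, h (h' hu)⟩
      · exact h'
    obtain ⟨s, hs, hsS⟩ := meets hu fun h => hA u h v (fun h' => hin ⟨h, h'⟩) huv
    obtain ⟨t, ht, htS⟩ := meets hv fun h => hA v h u (fun h' => hin ⟨h', h⟩) huv.symm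
    refine ⟨s, ⟨hs, hSA hsS⟩, t, ⟨ht, hSA htS⟩, addClique_adj.2 (Or.inr ⟨?_, hsS, htS⟩)⟩
    rintro rfl
    exact Set.disjoint_left.1 (hdisj hw.ne) hs ht

/-- Distinct nonadjacent vertices have a common neighbour outside any given pair of vertices. -/
def HasCommonNeighborsAvoidingPairs (H : SimpleGraph W) : Prop :=
  ∀ x y w w', w = w' ∨ H.Adj w w' ∨ ∃ z, z ≠ x ∧ z ≠ y ∧ H.Adj w z ∧ H.Adj z w'

/-- A minor of a highly connected graph lives on one of the two augmented sides of a separation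
of order at most two. -/
theorem IsMinorWithin.side_of_separation [Nonempty W] (hH : H.HasCommonNeighborsAvoidingPairs)
    {C U : Set V} {a b : V} (haC : a ∉ C) (hbC : b ∉ C)
    (hC : ∀ u ∈ C, ∀ v, v ∉ ({a, b} : Set V) → G.Adj u v → v ∈ C)
    (h : H.IsMinorWithin G U) :
    H.IsMinorWithin (G.addClique {a, b}) (U ∩ (C ∪ {a, b})) ∨
      H.IsMinorWithin (G.addClique {a, b}) (U ∩ Cᶜ) := by
  obtain ⟨f, hconn, hdisj, hadj, hU⟩ := h
  have owner : ∀ s, ∃ x, ∀ w, s ∈ f w → w = x := by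
    intro s
    by_cases hs : ∃ x, s ∈ f x
    · obtain ⟨x, hx⟩ := hs
      refine ⟨x, fun w hw => ?_⟩
      by_contra hne
      exact Set.disjoint_left.1 (hdisj hne) hw hx
    · exact ⟨Classical.arbitrary W, fun w hw => absurd ⟨w, hw⟩ hs⟩
  obtain ⟨x, hx⟩ := owner a
  obtain ⟨y, hy⟩ := owner b
  have avoids : ∀ {w}, w ≠ x → w ≠ y → ¬ (f w ∩ {a, b}).Nonempty := by
    rintro w hwx hwy ⟨u, hu, rfl | rfl⟩
    · exact hwx (hx w hu)
    · exact hwy (hy w hu)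
  have whole : ∀ {w u}, ¬ (f w ∩ {a, b}).Nonempty → u ∈ f w → u ∈ C → f w ⊆ C := by
    intro w u hw hu huC v hv
    exact (hconn w).forall_mem_of_adj (P := (· ∈ C))
      (fun p _ q hq hpq hp => hC p hp q (fun h => hw ⟨q, hq, h⟩) hpq) hu hv huC
  have step : ∀ {w w'}, ¬ (f w' ∩ {a, b}).Nonempty → H.Adj w w' → f w ⊆ C → f w' ⊆ C := by
    intro w w' hw' hww' hwC
    obtain ⟨p, hp, q, hq, hpq⟩ := hadj hww'
    exact whole hw' hq (hC p (hwC hp) q (fun h => hw' ⟨q, hq, h⟩) hpq)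
  by_cases hex : ∃ w, f w ⊆ C
  · left
    obtain ⟨w, hw⟩ := hex
    refine isMinorWithin_addClique_of_side Set.subset_union_right ?_ hconn hdisj hadj hU
      fun w' => ?_
    · rintro u (hu | hu) v hv huv
      · exact absurd (Or.inl (hC u hu v (fun h => hv (Or.inr h)) huv)) hv
      · exact hu
    · refine or_iff_not_imp_right.2 fun hw' => ?_
      refine Set.Subset.trans ?_ Set.subset_union_left
      rcases hH x y w w' with rfl | hww' | ⟨z, hzx, hzy, hwz, hzw'⟩
      · exact hw
      · exact step hw' hww' hw
      · exact step hw' hzw' (step (avoids hzx hzy) hwz hw)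
  · right
    refine isMinorWithin_addClique_of_side ?_ ?_ hconn hdisj hadj hU fun w => ?_
    · rintro u (rfl | rfl)
      exacts [haC, hbC]
    · intro u hu v hv huv
      by_contra hS
      exact hu (hC v (not_not.1 hv) u hS huv.symm)
    · exact or_iff_not_imp_right.2 fun hw u hu huC => hex ⟨w, whole hw hu huC⟩

theorem K5_hasCommonNeighborsAvoidingPairs : K5.HasCommonNeighborsAvoidingPairs := by
  intro x y w w'
  exact (eq_or_ne w w').imp_right Or.inl

theorem K33_hasCommonNeighborsAvoidingPairs : K33.HasCommonNeighborsAvoidingPairs := by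
  have adj : ∀ i j : Fin 6, K33.Adj i j ↔ (i.val < 3 ↔ 3 ≤ j.val) := by
    simp only [K33, fromRel_adj]
    decide
  simp only [HasCommonNeighborsAvoidingPairs, adj]
  decide

/-- Contracting a connected set `C`, adjacent to both `a` and `b`, into `a` turns `{a, b}` into
a clique. -/
theorem induce_addClique_isMinorOf {C : Set V} {a b : V}
    (hconn : (G.induce C).Connected) (ha : ∃ c ∈ C, G.Adj c a) (hb : ∃ c ∈ C, G.Adj c b) :
    ((G.addClique {a, b}).induce Cᶜ).IsMinorOf G := by
  classical
  obtain ⟨p, hpC, hpa⟩ := ha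
  obtain ⟨q, hqC, hqb⟩ := hb
  let f : ↥Cᶜ → Set V := fun w => if w.1 = a then {a} ∪ C else {w.1}
  have mem_self : ∀ w : ↥Cᶜ, w.1 ∈ f w := by
    intro w
    by_cases h : w.1 = a <;> simp [f, h]
  refine ⟨f, fun w => ?_, fun w w' hw => ?_, fun w w' hw => ?_⟩
  · by_cases h : w.1 = a
    · rw [show f w = {a} ∪ C from if_pos h]
      exact connected_induce_union Connected.of_subsingleton.preconnected hconn.preconnected
        rfl hpC hpa.symm
    · rw [show f w = {w.1} from if_neg h]
      exact Connected.of_subsingleton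
  · have hne : w.1 ≠ w'.1 := fun h => hw (Subtype.ext h)
    refine Set.disjoint_left.2 fun z hz hz' => ?_
    have h₁ := w.2
    have h₂ := w'.2
    simp only [f, Set.mem_compl_iff] at hz hz' h₁ h₂
    split_ifs at hz hz' <;> simp at hz hz' <;> grind
  · rcases addClique_adj.1 hw with h | ⟨hne, h₁, h₂⟩
    · exact ⟨w, mem_self w, w', mem_self w', h⟩
    · have hq : ∀ z : ↥Cᶜ, z.1 = a → q ∈ f z := fun z hz => by simp [f, hz, hqC]
      rcases h₁ with h₁ | h₁ <;> rcases h₂ with h₂ | h₂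
      · exact absurd (h₁.trans h₂.symm) hne
      · exact ⟨q, hq w h₁, b, h₂ ▸ mem_self w', hqb⟩
      · exact ⟨b, h₁ ▸ mem_self w, q, hq w' h₂, hqb.symm⟩
      · exact absurd (h₁.trans h₂.symm) hne

theorem connected_induce_compl_singleton [Fintype V] (hk : vConn G = 2) (b : V) :
    (G.induce ({b} : Set V)ᶜ).Connected := by
  have hmem : vConn G ∈ {k : ℕ | ∀ s : Finset V, s.card < k →
      (G.induce ((↑s : Set V)ᶜ)).Connected} := by
    refine Nat.sSup_mem ?_ ?_
    · exact ⟨0, fun s hs => absurd hs (Nat.not_lt_zero _)⟩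
    · by_contra hbdd
      rw [vConn, csSup_of_not_bddAbove hbdd] at hk
      simp at hk
  rw [hk] at hmem
  have h := hmem {b} (by simp)
  rwa [Finset.coe_singleton] at h

/-- In the absence of cut vertices, a component of `G - {a, b}` has a neighbour at `a`. -/
theorem exists_adj_of_component {C : Set V} {a b : V} (hab : a ≠ b) (haC : a ∉ C) (hbC : b ∉ C)
    (hb : (G.induce ({b} : Set V)ᶜ).Connected) (hne : C.Nonempty)
    (hC : ∀ u ∈ C, ∀ v, v ∉ ({a, b} : Set V) → G.Adj u v → v ∈ C) :
    ∃ c ∈ C, G.Adj c a := by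
  by_contra! h
  obtain ⟨c, hc⟩ := hne
  refine haC (hb.forall_mem_of_adj (P := (· ∈ C)) ?_ (u := c) (v := a) ?_ hab hc)
  · intro x _ y hy hxy hx
    refine hC x hx y ?_ hxy
    rintro (rfl | rfl)
    · exact h x hx hxy
    · exact hy rfl
  · rintro rfl
    exact hbC hc

/-- A graph `G[U]` is planar if the augmented component is planar and so is the part within `U` of
the other augmented side. -/
theorem isPlanar_induce_of_sides {C U : Set V} {a b : V} (haC : a ∉ C) (hbC : b ∉ C)
    (hC : ∀ u ∈ C, ∀ v, v ∉ ({a, b} : Set V) → G.Adj u v → v ∈ C)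
    (hplanar : IsPlanar (augment G {a, b} C))
    (hrest : IsPlanar (((G.addClique {a, b}).induce Cᶜ).induce (Subtype.val ⁻¹' U))) :
    IsPlanar (G.induce U) := by
  have key : ∀ {n : ℕ} {H : SimpleGraph (Fin (n + 1))}, H.HasCommonNeighborsAvoidingPairs →
      ¬ H.IsMinorOf (augment G {a, b} C) →
      ¬ H.IsMinorOf (((G.addClique {a, b}).induce Cᶜ).induce (Subtype.val ⁻¹' U)) →
      ¬ H.IsMinorOf (G.induce U) := by
    intro n H hH h₁ h₂ h
    rcases h.isMinorWithin_of_induce.side_of_separation hH haC hbC hC with h | h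
    · rw [← induce_addClique] at h₁
      exact h₁ (h.induce Set.inter_subset_right).isMinorOf
    · refine h₂ ((h.induce Set.inter_subset_right).induce ?_).isMinorOf
      exact Set.preimage_mono Set.inter_subset_left
  exact ⟨key K5_hasCommonNeighborsAvoidingPairs hplanar.1 hrest.1,
    key K33_hasCommonNeighborsAvoidingPairs hplanar.2 hrest.2⟩

theorem isPlanar_induce_univ_iff : IsPlanar (G.induce Set.univ) ↔ IsPlanar G := by
  have key : ∀ {W : Type} {H : SimpleGraph W}, H.IsMinorOf (G.induce Set.univ) ↔ H.IsMinorOf G :=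
    ⟨fun h => h.isMinorWithin_of_induce.isMinorOf,
      fun h => (h.isMinorWithin_univ.induce subset_rfl).isMinorOf⟩
  simp only [IsPlanar, key]

end SimpleGraph

/-- In an apex obstruction of connectivity two, the augmentation of every component of
`G − S` (for any 2-cut `S`) is non-planar. -/
theorem augmented_component_nonplanar {V : Type} [Fintype V] (G : SimpleGraph V)
    (hG : IsApexObstruction G) (hk : vConn G = 2) (S : Set V) (hS : IsTwoCut G S)
    (C : Set V) (hC : IsCompOf G S C) : ¬ IsPlanar (augment G S C) := by
  obtain ⟨a, b, hab, rfl⟩ := Set.ncard_eq_two.1 hS.1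
  obtain ⟨hne, hdisj, hconn, hclosed⟩ := hC
  have haC : a ∉ C := fun h => Set.disjoint_left.1 hdisj h (Or.inl rfl)
  have hbC : b ∉ C := fun h => Set.disjoint_left.1 hdisj h (Or.inr rfl)
  intro hplanar
  have ha := exists_adj_of_component hab haC hbC (connected_induce_compl_singleton hk b) hne hclosed
  have hb := exists_adj_of_component hab.symm hbC haC (connected_induce_compl_singleton hk a) hne
    (by simpa only [Set.pair_comm b a] using hclosed)
  have hiso : IsEmpty (((G.addClique {a, b}).induce Cᶜ) ≃g G) := by
    refine ⟨fun e => ?_⟩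
    obtain ⟨c, hc⟩ := hne
    obtain ⟨x, hx⟩ := Finite.surjective_of_injective
      (f := fun v : V => (e.symm v : V)) (Subtype.val_injective.comp e.symm.injective) c
    subst hx
    exact (e.symm x).2 hc
  refine hG.1 ?_
  rcases hG.2 _ _ (induce_addClique_isMinorOf hconn ha hb) hiso with h | ⟨v, h⟩
  · refine Or.inl (isPlanar_induce_univ_iff.1
      (isPlanar_induce_of_sides haC hbC hclosed hplanar ?_))
    rw [Set.preimage_univ]
    exact isPlanar_induce_univ_iff.2 h
  · refine Or.inr ⟨v, isPlanar_induce_of_sides haC hbC hclosed hplanar ?_⟩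
    have : {u | u ≠ v} = Subtype.val ⁻¹' {u : V | u ≠ v} := by
      ext u
      exact Subtype.coe_injective.ne_iff.symm
    rwa [this] at h
end

section
/- If G ∈ F, κ(G) = 2, and S is any basic 2-cut of G, then the augmented component of the light component of G − S is isomorphic to K_5, to K_{3,3}, or to K_{3,3}+e (K_{3,3} with one additional edge joining two vertices in the same part). -/
open SimpleGraph

section ConnectedSets

variable {V W U : Type}

/-- `X` is nonempty and induces a connected subgraph: a subset of `X` that meets `X` and is
closed under adjacency in `X` is everything. -/
def ConnectedOn (G : SimpleGraph V) (X : Set V) : Prop :=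
  X.Nonempty ∧ ∀ T : Set V, (∃ x ∈ X, x ∈ T) →
    (∀ u ∈ X, u ∈ T → ∀ v ∈ X, G.Adj u v → v ∈ T) → X ⊆ T

theorem connectedOn_iff {G : SimpleGraph V} {X : Set V} :
    ConnectedOn G X ↔ (G.induce X).Connected := by
  constructor
  · rintro ⟨⟨x₀, hx₀⟩, h⟩
    have : Nonempty X := ⟨⟨x₀, hx₀⟩⟩
    refine ⟨fun x y => ?_⟩
    have := h {z | ∃ hz : z ∈ X, (G.induce X).Reachable x ⟨z, hz⟩} ⟨x, x.2, x.2, .refl _⟩ (by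
      rintro u hu ⟨_, hr⟩ v hv huv
      exact ⟨hv, hr.trans (Adj.reachable (by simpa using huv))⟩) y.2
    exact this.2
  · intro h
    obtain ⟨x₀⟩ := h.nonempty
    refine ⟨⟨x₀, x₀.2⟩, ?_⟩
    rintro T ⟨x, hx, hxT⟩ hT y hy
    obtain ⟨p⟩ := h.preconnected ⟨x, hx⟩ ⟨y, hy⟩
    have key : ∀ (u v : X), (G.induce X).Walk u v → (u : V) ∈ T → (v : V) ∈ T := by
      intro u v p
      induction p with
      | nil => exact id
      | @cons u v w huv _ ih => exact fun hu => ih (hT u u.2 hu v v.2 (by simpa using huv))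
    exact key _ _ p hxT

theorem ConnectedOn.mono {G H : SimpleGraph V} (h : G ≤ H) {X : Set V} (hX : ConnectedOn G X) :
    ConnectedOn H X :=
  ⟨hX.1, fun T hT hc => hX.2 T hT fun u hu huT v hv huv => hc u hu huT v hv (h huv)⟩

theorem connectedOn_singleton (G : SimpleGraph V) (x : V) : ConnectedOn G {x} := by
  refine ⟨⟨x, rfl⟩, ?_⟩
  rintro T ⟨y, rfl, hy⟩ _ z rfl
  exact hy

theorem ConnectedOn.union {G : SimpleGraph V} {X Y : Set V} (hX : ConnectedOn G X)
    (hY : ConnectedOn G Y) {x y : V} (hx : x ∈ X) (hy : y ∈ Y) (hxy : G.Adj x y) :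
    ConnectedOn G (X ∪ Y) := by
  refine ⟨⟨x, .inl hx⟩, ?_⟩
  rintro T ⟨z, hz, hzT⟩ hT
  have hX' : (∃ x ∈ X, x ∈ T) → X ⊆ T := fun h => hX.2 T h fun u hu huT v hv =>
    hT u (.inl hu) huT v (.inl hv)
  have hY' : (∃ x ∈ Y, x ∈ T) → Y ⊆ T := fun h => hY.2 T h fun u hu huT v hv =>
    hT u (.inr hu) huT v (.inr hv)
  rcases hz with hz | hz
  · have h1 := hX' ⟨z, hz, hzT⟩
    exact Set.union_subset h1 (hY' ⟨y, hy, hT x (.inl hx) (h1 hx) y (.inr hy) hxy⟩)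
  · have h1 := hY' ⟨z, hz, hzT⟩
    exact Set.union_subset (hX' ⟨x, hx, hT y (.inr hy) (h1 hy) x (.inl hx) hxy.symm⟩) h1

theorem ConnectedOn.insert {G : SimpleGraph V} {X : Set V} (hX : ConnectedOn G X) {x y : V}
    (hx : x ∈ X) (hxy : G.Adj x y) : ConnectedOn G (X ∪ {y}) :=
  hX.union (connectedOn_singleton G y) hx rfl hxy

theorem ConnectedOn.exists_adj {G : SimpleGraph V} {X Y : Set V} (h : ConnectedOn G (X ∪ Y))
    (hX : X.Nonempty) (hY : Y.Nonempty) (hd : Disjoint X Y) :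
    ∃ x ∈ X, ∃ y ∈ Y, G.Adj x y := by
  by_contra! hc
  obtain ⟨x, hx⟩ := hX
  obtain ⟨y, hy⟩ := hY
  refine Set.disjoint_left.1 hd (h.2 X ⟨x, .inl hx, hx⟩ ?_ (.inr hy)) hy
  intro u _ huX v hv huv
  exact hv.resolve_right fun hvY => hc u huX v hvY huv

theorem ConnectedOn.image {G : SimpleGraph V} {H : SimpleGraph W} {X : Set V}
    (hX : ConnectedOn G X) (φ : V → W)
    (hφ : ∀ u ∈ X, ∀ v ∈ X, G.Adj u v → H.Adj (φ u) (φ v)) : ConnectedOn H (φ '' X) := by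
  refine ⟨hX.1.image φ, ?_⟩
  rintro T ⟨_, ⟨x, hx, rfl⟩, hxT⟩ hT
  rw [Set.image_subset_iff]
  exact hX.2 (φ ⁻¹' T) ⟨x, hx, hxT⟩ fun u hu huT v hv huv =>
    hT _ ⟨u, hu, rfl⟩ huT _ ⟨v, hv, rfl⟩ (hφ u hu v hv huv)

/-- A connected set with two marked vertices splits into two connected sets, one around each. -/
theorem ConnectedOn.exists_split {G : SimpleGraph V} {X : Set V} (hX : ConnectedOn G X)
    {a b : V} (ha : a ∈ X) (hb : b ∈ X) (hab : a ≠ b) :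
    ∃ Y Z : Set V, ConnectedOn G Y ∧ ConnectedOn G Z ∧ a ∈ Y ∧ b ∈ Z ∧ Disjoint Y Z ∧
      Y ∪ Z = X := by
  set Z : Set V := {y | ∃ Q ⊆ X \ {a}, ConnectedOn G Q ∧ b ∈ Q ∧ y ∈ Q}
  have hZX : Z ⊆ X := fun y ⟨Q, hQ, _, _, hy⟩ => (hQ hy).1
  have haZ : a ∉ Z := fun ⟨Q, hQ, _, _, hy⟩ => (hQ hy).2 rfl
  have hbZ : b ∈ Z := by
    refine ⟨{b}, ?_, connectedOn_singleton G b, rfl, rfl⟩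
    rintro _ rfl
    exact ⟨hb, hab.symm⟩
  have hZc : ∀ u ∈ Z, ∀ v ∈ X, v ≠ a → G.Adj u v → v ∈ Z := by
    rintro u ⟨Q, hQ, hQc, hbQ, huQ⟩ v hv hva huv
    refine ⟨Q ∪ {v}, Set.union_subset hQ ?_, hQc.insert huQ huv, .inl hbQ, .inr rfl⟩
    rintro _ rfl
    exact ⟨hv, hva⟩
  have key : ∀ T : Set V, (∃ x ∈ X \ Z, x ∈ T) →
      (∀ u ∈ X \ Z, u ∈ T → ∀ v ∈ X \ Z, G.Adj u v → v ∈ T) → a ∈ T := by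
    rintro T ⟨x, hx, hxT⟩ hT
    by_contra haT
    refine haT (hX.2 (T ∩ (X \ Z)) ⟨x, hx.1, hxT, hx⟩ ?_ ha).1
    rintro u _ ⟨huT, hu⟩ v hv huv
    have hvZ : v ∉ Z := fun hvZ =>
      hu.2 (hZc v hvZ u hu.1 (by rintro rfl; exact haT huT) huv.symm)
    exact ⟨hT u hu huT v ⟨hv, hvZ⟩ huv, hv, hvZ⟩
  refine ⟨X \ Z, Z, ⟨⟨a, ha, haZ⟩, ?_⟩, ⟨⟨b, hbZ⟩, ?_⟩, ⟨ha, haZ⟩, hbZ,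
    Set.disjoint_sdiff_left, Set.sdiff_union_of_subset hZX⟩
  · intro T hx hT
    have haT := key T hx hT
    intro y hy
    by_contra hyT
    refine key Tᶜ ⟨y, hy, hyT⟩ ?_ haT
    exact fun u hu huT v hv huv hvT => huT (hT v hv hvT u hu huv.symm)
  · rintro T ⟨y, ⟨Q, hQ, hQc, hbQ, hyQ⟩, hyT⟩ hT
    have hsub : ∀ Q ⊆ X \ {a}, ConnectedOn G Q → b ∈ Q → (∃ y ∈ Q, y ∈ T) → Q ⊆ T := by
      intro Q hQ hQc hbQ hy
      exact hQc.2 T hy fun u hu huT v hv => hT u ⟨Q, hQ, hQc, hbQ, hu⟩ huT v ⟨Q, hQ, hQc, hbQ, hv⟩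
    rintro z ⟨Q', hQ', hQc', hbQ', hzQ'⟩
    exact hsub Q' hQ' hQc' hbQ' ⟨b, hbQ', hsub Q hQ hQc hbQ ⟨y, hyQ, hyT⟩ hbQ⟩ hzQ'

/-- Some connected subset of `B` is adjacent to both `a` and `b`. -/
def Linked (G : SimpleGraph V) (B : Set V) (a b : V) : Prop :=
  ∃ Q ⊆ B, ConnectedOn G Q ∧ (∃ x ∈ Q, G.Adj a x) ∧ ∃ x ∈ Q, G.Adj b x

/-- Cutting a connected set along a separation with separator `{a, b}` keeps it connected,
provided that a link between `a` and `b` through the part cut off is replaced by an edge. -/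
theorem ConnectedOn.inter_side {G H : SimpleGraph V} (hGH : G ≤ H) {A B X : Set V} {a b : V}
    (hAB : ∀ u ∈ A, ∀ v ∈ B, ¬ G.Adj u v) (hH : Linked G B a b → H.Adj a b)
    (hX : ConnectedOn G X) (hXs : X ⊆ A ∪ {a, b} ∪ B) (hd : Disjoint (A ∪ {a, b}) B)
    (hne : (X ∩ (A ∪ {a, b})).Nonempty) : ConnectedOn H (X ∩ (A ∪ {a, b})) := by
  refine ⟨hne, ?_⟩
  rintro T ⟨x, hx, hxT⟩ hT
  have hlink : ∀ s ∈ ({a, b} : Set V), ∀ t ∈ ({a, b} : Set V), ∀ Q ⊆ B, ConnectedOn G Q →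
      (∃ x ∈ Q, G.Adj s x) → (∃ x ∈ Q, G.Adj t x) → s ≠ t → H.Adj s t := by
    rintro s (rfl | rfl) t (rfl | rfl) Q hQ hQc hs ht hne
    · exact absurd rfl hne
    · exact hH ⟨Q, hQ, hQc, hs, ht⟩
    · exact (hH ⟨Q, hQ, hQc, ht, hs⟩).symm
    · exact absurd rfl hne
  have hS : ∀ u ∈ A ∪ {a, b}, ∀ v ∈ B, G.Adj u v → u ∈ ({a, b} : Set V) :=
    fun u hu v hv huv => hu.resolve_left fun huA => hAB u huA v hv huv
  let T' : Set V := (X ∩ (A ∪ {a, b}) ∩ T) ∪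
    {u | u ∈ B ∧ ∃ Q ⊆ B, ConnectedOn G Q ∧ u ∈ Q ∧
      ∃ s ∈ X ∩ T, s ∈ ({a, b} : Set V) ∧ ∃ x ∈ Q, G.Adj s x}
  have hXT' : X ⊆ T' := by
    refine hX.2 T' ⟨x, hx.1, .inl ⟨hx, hxT⟩⟩ ?_
    rintro u hu huT v hv huv
    rcases huT with ⟨huA, huT⟩ | ⟨huB, Q, hQ, hQc, huQ, s, hs, hsS, hsQ⟩
    · rcases hXs hv with hvA | hvB
      · exact .inl ⟨⟨hv, hvA⟩, hT u huA huT v ⟨hv, hvA⟩ (hGH huv)⟩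
      · exact .inr ⟨hvB, {v}, by simpa using hvB, connectedOn_singleton G v, rfl,
          u, ⟨hu, huT⟩, hS u huA.2 v hvB huv, v, rfl, huv⟩
    · rcases hXs hv with hvA | hvB
      · refine .inl ⟨⟨hv, hvA⟩, ?_⟩
        by_cases hsv : s = v
        · exact hsv ▸ hs.2
        · exact hT s ⟨hs.1, .inr hsS⟩ hs.2 v ⟨hv, hvA⟩ (hlink s hsS v (hS v hvA u huB huv.symm)
            Q hQ hQc hsQ ⟨u, huQ, huv.symm⟩ hsv)
      · obtain ⟨x, hxQ, hsx⟩ := hsQ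
        exact .inr ⟨hvB, Q ∪ {v}, Set.union_subset hQ (by simpa using hvB), hQc.insert huQ huv,
          .inr rfl, s, hs, hsS, x, .inl hxQ, hsx⟩
  rintro y ⟨hyX, hyA⟩
  rcases hXT' hyX with h | h
  · exact h.2
  · exact absurd h.1 (Set.disjoint_left.1 hd hyA)

/-- An edge `ab` of a connected set containing `a` may be replaced by a link through `Q`. -/
theorem ConnectedOn.union_link {G : SimpleGraph V} {a b : V} {X Q : Set V}
    (hX : ConnectedOn (G ⊔ edge a b) X) (ha : a ∈ X) (hQ : ConnectedOn G Q)
    (haQ : ∃ x ∈ Q, G.Adj a x) (hbQ : ∃ x ∈ Q, G.Adj b x) : ConnectedOn G (X ∪ Q) := by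
  obtain ⟨p, hp, hap⟩ := haQ
  obtain ⟨q, hq, hbq⟩ := hbQ
  refine ⟨⟨a, .inl ha⟩, ?_⟩
  rintro T ⟨z, hz, hzT⟩ hT
  have hQ' : (∃ x ∈ Q, x ∈ T) → Q ⊆ T := fun h => hQ.2 T h fun u hu huT v hv =>
    hT u (.inr hu) huT v (.inr hv)
  have step : (∃ x ∈ X, x ∈ T) → X ⊆ T := by
    refine fun h => hX.2 T h ?_
    intro u hu huT v hv huv
    rcases huv with huv | huv
    · exact hT u (.inl hu) huT v (.inl hv) huv
    · rw [edge_adj] at huv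
      rcases huv with ⟨⟨rfl, rfl⟩ | ⟨rfl, rfl⟩, _⟩
      · have := hQ' ⟨p, hp, hT _ (.inl hu) huT p (.inr hp) hap⟩ hq
        exact hT q (.inr hq) this _ (.inl hv) hbq.symm
      · have := hQ' ⟨q, hq, hT _ (.inl hu) huT q (.inr hq) hbq⟩ hp
        exact hT p (.inr hp) this _ (.inl hv) hap.symm
  rcases hz with hz | hz
  · have h1 := step ⟨z, hz, hzT⟩
    exact Set.union_subset h1 (hQ' ⟨p, hp, hT a (.inl ha) (h1 ha) p (.inr hp) hap⟩)
  · have h1 := hQ' ⟨z, hz, hzT⟩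
    exact Set.union_subset (step ⟨a, ha, hT p (.inr hp) (h1 hp) a (.inl ha) hap.symm⟩) h1

theorem ConnectedOn.of_sup_edge {G : SimpleGraph V} {a b : V} {X : Set V}
    (hX : ConnectedOn (G ⊔ edge a b) X) (h : a ∉ X ∨ b ∉ X) : ConnectedOn G X := by
  refine ⟨hX.1, fun T hx hT => hX.2 T hx fun u hu huT v hv huv => ?_⟩
  rcases huv with huv | huv
  · exact hT u hu huT v hv huv
  · rw [edge_adj] at huv
    rcases huv with ⟨⟨rfl, rfl⟩ | ⟨rfl, rfl⟩, _⟩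
    · exact absurd h (by simp [hu, hv])
    · exact absurd h (by simp [hu, hv])

end ConnectedSets

section Models

variable {V W U : Type}

/-- `f` is a family of branch sets inside `X` witnessing that `K` is a minor of `G`. -/
structure IsModel (K : SimpleGraph W) (G : SimpleGraph V) (X : Set V) (f : W → Set V) : Prop where
  connectedOn : ∀ w, ConnectedOn G (f w)
  subset : ∀ w, f w ⊆ X
  disjoint : ∀ ⦃w w'⦄, w ≠ w' → Disjoint (f w) (f w')
  exists_adj : ∀ ⦃w w'⦄, K.Adj w w' → ∃ u ∈ f w, ∃ v ∈ f w', G.Adj u v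

/-- `K` is a minor of the subgraph of `G` induced by `X`. -/
def HasModelOn (K : SimpleGraph W) (G : SimpleGraph V) (X : Set V) : Prop :=
  ∃ f, IsModel K G X f

theorem IsModel.eq_of_mem {K : SimpleGraph W} {G : SimpleGraph V} {X : Set V} {f : W → Set V}
    (hf : IsModel K G X f) {w w' : W} {x : V} (h : x ∈ f w) (h' : x ∈ f w') : w = w' := by
  by_contra hne
  exact Set.disjoint_left.1 (hf.disjoint hne) h h'

theorem IsModel.isMinorOf {K : SimpleGraph W} {G : SimpleGraph V} {X : Set V} {f : W → Set V}
    (hf : IsModel K G X f) : K.IsMinorOf G :=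
  ⟨f, fun w => connectedOn_iff.1 (hf.connectedOn w), fun _ _ h => hf.disjoint h, hf.exists_adj⟩

theorem HasModelOn.mono {K K' : SimpleGraph W} {G G' : SimpleGraph V} {X X' : Set V}
    (h : HasModelOn K G X) (hK : K' ≤ K) (hG : G ≤ G') (hX : X ⊆ X') : HasModelOn K' G' X' := by
  obtain ⟨f, hf⟩ := h
  refine ⟨f, fun w => (hf.connectedOn w).mono hG, fun w => (hf.subset w).trans hX, hf.disjoint,
    fun w w' hw => ?_⟩
  obtain ⟨u, hu, v, hv, huv⟩ := hf.exists_adj (hK hw)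
  exact ⟨u, hu, v, hv, hG huv⟩

theorem HasModelOn.map {K : SimpleGraph W} {G : SimpleGraph V} {H : SimpleGraph U} {X : Set V}
    (h : HasModelOn K G X) (φ : V → U) (hinj : Set.InjOn φ X)
    (hφ : ∀ u ∈ X, ∀ v ∈ X, G.Adj u v → H.Adj (φ u) (φ v)) : HasModelOn K H (φ '' X) := by
  obtain ⟨f, hf⟩ := h
  refine ⟨fun w => φ '' f w, fun w => (hf.connectedOn w).image φ fun u hu v hv =>
    hφ u (hf.subset w hu) v (hf.subset w hv), fun w => Set.image_mono (hf.subset w), ?_, ?_⟩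
  · intro w w' hw
    rw [Set.disjoint_left]
    rintro _ ⟨x, hx, rfl⟩ ⟨y, hy, hxy⟩
    have := hinj (hf.subset w' hy) (hf.subset w hx) hxy
    subst this
    exact hw (hf.eq_of_mem hx hy)
  · intro w w' hw
    obtain ⟨u, hu, v, hv, huv⟩ := hf.exists_adj hw
    exact ⟨_, ⟨u, hu, rfl⟩, _, ⟨v, hv, rfl⟩, hφ u (hf.subset w hu) v (hf.subset w' hv) huv⟩

theorem hasModelOn_univ {K : SimpleGraph W} {G : SimpleGraph V} :
    HasModelOn K G Set.univ ↔ K.IsMinorOf G := by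
  constructor
  · rintro ⟨f, hf⟩
    exact hf.isMinorOf
  · rintro ⟨f, h1, h2, h3⟩
    exact ⟨f, fun w => connectedOn_iff.2 (h1 w), fun w => Set.subset_univ _, fun _ _ h => h2 h, h3⟩

theorem HasModelOn.induce {K : SimpleGraph W} {G : SimpleGraph V} {X Y : Set V}
    (h : HasModelOn K G Y) (hYX : Y ⊆ X) : HasModelOn K (G.induce X) (Subtype.val ⁻¹' Y) := by
  obtain ⟨f, hf⟩ := h
  have hfX : ∀ w, f w ⊆ X := fun w => (hf.subset w).trans hYX
  refine ⟨fun w => Subtype.val ⁻¹' f w, fun w => ?_,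
    fun w => Set.preimage_mono (hf.subset w), fun w w' h => (hf.disjoint h).preimage _, ?_⟩
  · obtain ⟨x, hx⟩ := (hf.connectedOn w).1
    refine ⟨⟨⟨x, hfX w hx⟩, hx⟩, ?_⟩
    rintro T ⟨y, hy, hyT⟩ hT z hz
    obtain ⟨z', hz', hzz'⟩ := (hf.connectedOn w).2 (Subtype.val '' T) ⟨y, hy, y, hyT, rfl⟩ (by
      rintro _ hu ⟨u, huT, rfl⟩ v hv huv
      exact ⟨⟨v, hfX w hv⟩, hT u hu huT _ hv (by simpa using huv), rfl⟩) hz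
    rwa [← Subtype.ext hzz']
  · intro w w' hw
    obtain ⟨u, hu, v, hv, huv⟩ := hf.exists_adj hw
    exact ⟨⟨u, hfX w hu⟩, hu, ⟨v, hfX w' hv⟩, hv, by simpa using huv⟩

theorem hasModelOn_iff {K : SimpleGraph W} {G : SimpleGraph V} {X : Set V} :
    HasModelOn K G X ↔ K.IsMinorOf (G.induce X) := by
  constructor
  · exact fun h => hasModelOn_univ.1 ((h.induce subset_rfl).mono le_rfl le_rfl (Set.subset_univ _))
  · intro h
    have := (hasModelOn_univ.2 h).map (H := G) Subtype.val Subtype.val_injective.injOn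
      fun u _ v _ huv => by simpa using huv
    simpa using this

/-- An edge `ab` may be replaced by a link between `a` and `b` outside the model. -/
theorem HasModelOn.of_link {K : SimpleGraph W} {G : SimpleGraph V} {X Q : Set V} {a b : V}
    (h : HasModelOn K (G ⊔ edge a b) X) (hQ : ConnectedOn G Q) (hd : Disjoint X Q)
    (haQ : ∃ x ∈ Q, G.Adj a x) (hbQ : ∃ x ∈ Q, G.Adj b x) : HasModelOn K G (X ∪ Q) := by
  classical
  obtain ⟨f, hf⟩ := h
  have hfQ : ∀ w, Disjoint (f w) Q := fun w => hd.mono_left (hf.subset w)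
  obtain ⟨q, hq, hbq⟩ := hbQ
  refine ⟨fun w => if a ∈ f w then f w ∪ Q else f w, fun w => ?_, fun w => ?_, ?_, ?_⟩
  · split_ifs with ha
    · exact (hf.connectedOn w).union_link ha hQ haQ ⟨q, hq, hbq⟩
    · exact (hf.connectedOn w).of_sup_edge (.inl ha)
  · split_ifs with ha
    · exact Set.union_subset_union_left _ (hf.subset w)
    · exact (hf.subset w).trans Set.subset_union_left
  · intro w w' hw
    split_ifs with h1 h2 h2
    · exact absurd (hf.eq_of_mem h1 h2) hw
    · exact (hf.disjoint hw).union_left (hfQ w').symm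
    · exact (hf.disjoint hw).union_right (hfQ w)
    · exact hf.disjoint hw
  · have hsub : ∀ w x, x ∈ f w → x ∈ if a ∈ f w then f w ∪ Q else f w := by
      intro w x hx
      split_ifs
      · exact .inl hx
      · exact hx
    intro w w' hw
    obtain ⟨u, hu, v, hv, huv⟩ := hf.exists_adj hw
    rcases huv with huv | huv
    · exact ⟨u, hsub w u hu, v, hsub w' v hv, huv⟩
    · rw [edge_adj] at huv
      rcases huv with ⟨⟨rfl, rfl⟩ | ⟨rfl, rfl⟩, _⟩
      · exact ⟨q, by simp [hu, hq], _, hsub w' _ hv, hbq.symm⟩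
      · exact ⟨_, hsub w _ hu, q, by simp [hv, hq], hbq⟩

theorem HasModelOn.subdivideEdge {K : SimpleGraph W} {G : SimpleGraph V} {u v : V}
    (h : HasModelOn K G Set.univ) : HasModelOn K (subdivideEdge G u v) Set.univ := by
  have h' : HasModelOn K (_root_.subdivideEdge G u v ⊔ edge (some u) (some v))
      (some '' (Set.univ : Set V)) := by
    refine h.map some (Option.some_injective V).injOn fun x _ y _ hxy => ?_
    simp only [_root_.subdivideEdge, SimpleGraph.sup_adj, fromRel_adj, edge_adj]
    by_cases hs : s(x, y) = s(u, v)
    · right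
      have : x ≠ y := hxy.ne
      simpa [this] using hs
    · left
      exact ⟨by simpa using hxy.ne, .inl (.inl ⟨x, y, rfl, rfl, hxy, hs⟩)⟩
  refine (h'.of_link (Q := {none}) (connectedOn_singleton _ _) (by simp) ⟨none, rfl, ?_⟩
    ⟨none, rfl, ?_⟩).mono le_rfl le_rfl (Set.subset_univ _)
  · simp [_root_.subdivideEdge]
  · simp [_root_.subdivideEdge]

theorem HasModelOn.of_iso {K : SimpleGraph W} {G : SimpleGraph V} {H : SimpleGraph U}
    (h : HasModelOn K G Set.univ) (e : G ≃g H) : HasModelOn K H Set.univ :=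
  (h.map e e.injective.injOn fun _ _ _ _ huv => e.map_adj_iff.2 huv).mono le_rfl le_rfl
    (Set.subset_univ _)

theorem hasModelOn_self (G : SimpleGraph V) : HasModelOn G G Set.univ :=
  ⟨fun v => {v}, connectedOn_singleton G, fun _ => Set.subset_univ _, fun v w h => by simpa using h,
    fun v w h => ⟨v, rfl, w, rfl, h⟩⟩

theorem IsSubdivision.hasModelOn {K : SimpleGraph W} {H : SimpleGraph U}
    (h : IsSubdivision K H) : HasModelOn K H Set.univ := by
  induction h with
  | of_iso e => exact (hasModelOn_self _).of_iso e
  | step _ _ e ih => exact ih.subdivideEdge.of_iso e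

/-- A form of 3-connectedness: distinct nonadjacent vertices have a common neighbour avoiding any
two given vertices, and every vertex has a neighbour avoiding any two given vertices. -/
structure IsRobust (K : SimpleGraph W) : Prop where
  exists_common : ∀ w w', w ≠ w' → K.Adj w w' ∨
    ∀ p q, ∃ x, x ≠ p ∧ x ≠ q ∧ K.Adj w x ∧ K.Adj x w'
  exists_neighbor : ∀ w p q, ∃ x, x ≠ p ∧ x ≠ q ∧ K.Adj w x

/-- A minor model of a 3-connected graph lives on one side of a 2-separation, up to replacing a
link between the separating vertices through the other side by an edge. -/
theorem HasModelOn.separate {K : SimpleGraph W} (hK : IsRobust K) {G G₁ G₂ : SimpleGraph V}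
    {A B : Set V} {a b : V} (h : HasModelOn K G (A ∪ {a, b} ∪ B))
    (hAB : ∀ u ∈ A, ∀ v ∈ B, ¬ G.Adj u v) (hA : Disjoint A {a, b}) (hB : Disjoint B {a, b})
    (hd : Disjoint A B) (h₁ : G ≤ G₁) (h₂ : G ≤ G₂) (hl₁ : Linked G B a b → G₁.Adj a b)
    (hl₂ : Linked G A a b → G₂.Adj a b) :
    HasModelOn K G₁ (A ∪ {a, b}) ∨ HasModelOn K G₂ (B ∪ {a, b}) := by
  obtain ⟨f, hf⟩ := h
  have key : ∀ (A B : Set V) (H : SimpleGraph V), (∀ u ∈ A, ∀ v ∈ B, ¬ G.Adj u v) →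
      (∀ w, f w ⊆ A ∪ {a, b} ∪ B) → Disjoint A B → Disjoint B {a, b} → G ≤ H →
      (Linked G B a b → H.Adj a b) → (∀ w, (f w ∩ (A ∪ {a, b})).Nonempty) →
      HasModelOn K H (A ∪ {a, b}) := by
    intro A B H hAB hs hd hB hGH hl hne
    have hd' : Disjoint (A ∪ {a, b}) B := hd.union_left hB.symm
    refine ⟨fun w => f w ∩ (A ∪ {a, b}), fun w => ?_, fun w => Set.inter_subset_right,
      fun w w' hw => (hf.disjoint hw).mono Set.inter_subset_left Set.inter_subset_left, ?_⟩
    · exact (hf.connectedOn w).inter_side hGH hAB hl (hs w) hd' (hne w)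
    · intro w w' hw
      obtain ⟨u, hu, v, hv, huv⟩ := hf.exists_adj hw
      have hc := ((hf.connectedOn w).union (hf.connectedOn w') hu hv huv).inter_side hGH hAB hl
        (Set.union_subset (hs w) (hs w')) hd' ((hne w).mono
          (Set.inter_subset_inter_left _ Set.subset_union_left))
      rw [Set.union_inter_distrib_right] at hc
      exact hc.exists_adj (hne w) (hne w') ((hf.disjoint hw.ne).mono Set.inter_subset_left
        Set.inter_subset_left)
  by_cases hall : ∀ w, (f w ∩ (A ∪ {a, b})).Nonempty
  · exact .inl (key A B G₁ hAB hf.subset hd hB h₁ hl₁ hall)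
  by_cases hall' : ∀ w, (f w ∩ (B ∪ {a, b})).Nonempty
  · refine .inr (key B A G₂ (fun u hu v hv huv => hAB v hv u hu huv.symm) (fun w => ?_) hd.symm hA
      h₂ hl₂ hall')
    rw [Set.union_assoc, Set.union_comm {a, b} A, Set.union_comm B]
    exact hf.subset w
  exfalso
  simp only [not_forall, Set.not_nonempty_iff_eq_empty, ← Set.disjoint_iff_inter_eq_empty] at hall hall'
  obtain ⟨w, hw⟩ := hall
  obtain ⟨w', hw'⟩ := hall'
  have hwB : f w ⊆ B := fun x hx => (hf.subset w hx).resolve_left (Set.disjoint_left.1 hw hx)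
  have hwA : f w' ⊆ A := fun x hx => by
    rcases hf.subset w' hx with (h | h) | h
    · exact h
    · exact absurd (.inr h) (Set.disjoint_left.1 hw' hx)
    · exact absurd (.inl h) (Set.disjoint_left.1 hw' hx)
  have noadj : ∀ x y, f x ⊆ B → f y ⊆ A → ¬ K.Adj x y := by
    intro x y hx hy hxy
    obtain ⟨u, hu, v, hv, huv⟩ := hf.exists_adj hxy
    exact hAB v (hy hv) u (hx hu) huv.symm
  have hne : w ≠ w' := by
    rintro rfl
    obtain ⟨x, hx⟩ := (hf.connectedOn w).1
    exact Set.disjoint_left.1 hd (hwA hx) (hwB hx)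
  obtain ⟨p, hp⟩ : ∃ p, ∀ x, a ∈ f x → x = p := by
    by_cases hx : ∃ x, a ∈ f x
    · obtain ⟨p, hp⟩ := hx
      exact ⟨p, fun x hx => hf.eq_of_mem hx hp⟩
    · exact ⟨w, fun x hx' => absurd ⟨x, hx'⟩ hx⟩
  obtain ⟨q, hq⟩ : ∃ q, ∀ x, b ∈ f x → x = q := by
    by_cases hx : ∃ x, b ∈ f x
    · obtain ⟨p, hp⟩ := hx
      exact ⟨p, fun x hx => hf.eq_of_mem hx hp⟩
    · exact ⟨w, fun x hx' => absurd ⟨x, hx'⟩ hx⟩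
  rcases hK.exists_common w w' hne with hadj | hcom
  · exact noadj w w' hwB hwA hadj
  obtain ⟨x, hxp, hxq, hwx, hxw'⟩ := hcom p q
  have hxs : f x ⊆ A ∪ B := fun y hy => by
    rcases hf.subset x hy with (h | rfl | rfl) | h
    · exact .inl h
    · exact absurd (hp x hy) hxp
    · exact absurd (hq x hy) hxq
    · exact .inr h
  by_cases hxA : f x ⊆ A
  · exact noadj w x hwB hxA hwx
  by_cases hxB : f x ⊆ B
  · exact noadj x w' hxB hwA hxw'
  have hunion : (f x ∩ A) ∪ (f x ∩ B) = f x := by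
    rw [← Set.inter_union_distrib_left, Set.inter_eq_left.2 hxs]
  rw [Set.not_subset] at hxA hxB
  obtain ⟨y, hy, hyA⟩ := hxA
  obtain ⟨z, hz, hzB⟩ := hxB
  have hc := hf.connectedOn x
  rw [← hunion] at hc
  obtain ⟨u, hu, v, hv, huv⟩ := hc.exists_adj ⟨z, hz, (hxs hz).resolve_right hzB⟩
    ⟨y, hy, (hxs hy).resolve_left hyA⟩ (hd.mono Set.inter_subset_right Set.inter_subset_right)
  exact hAB u hu.2 v hv.2 huv

end Models

section Kuratowski

instance : DecidableRel K5.Adj := inferInstanceAs (DecidableRel (⊤ : SimpleGraph (Fin 5)).Adj)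

instance : DecidableRel K33.Adj := fun i j =>
  inferInstanceAs (Decidable (i ≠ j ∧ ((i.val < 3 ∧ 3 ≤ j.val) ∨ (j.val < 3 ∧ 3 ≤ i.val))))

instance : DecidableRel K33e.Adj := fun i j =>
  inferInstanceAs (Decidable (i ≠ j ∧ (((i.val < 3 ∧ 3 ≤ j.val) ∨ (i.val = 0 ∧ j.val = 1)) ∨
    ((j.val < 3 ∧ 3 ≤ i.val) ∨ (j.val = 0 ∧ i.val = 1)))))

theorem isRobust_K5 : IsRobust K5 := ⟨by decide +kernel, by decide +kernel⟩

theorem isRobust_K33 : IsRobust K33 := ⟨by decide +kernel, by decide +kernel⟩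

variable {V W U : Type}

/-- The subgraph of `G` induced by `X` is nonplanar. -/
def NonplanarOn (G : SimpleGraph V) (X : Set V) : Prop :=
  HasModelOn K5 G X ∨ HasModelOn K33 G X

theorem not_isPlanar_induce {G : SimpleGraph V} {X : Set V} :
    ¬ IsPlanar (G.induce X) ↔ NonplanarOn G X := by
  rw [IsPlanar, NonplanarOn, hasModelOn_iff, hasModelOn_iff]
  tauto

theorem not_isPlanar {G : SimpleGraph V} : ¬ IsPlanar G ↔ NonplanarOn G Set.univ := by
  rw [IsPlanar, NonplanarOn, hasModelOn_univ, hasModelOn_univ]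
  tauto

theorem NonplanarOn.mono {G G' : SimpleGraph V} {X X' : Set V} (h : NonplanarOn G X)
    (hG : G ≤ G') (hX : X ⊆ X') : NonplanarOn G' X' :=
  h.imp (fun h => h.mono le_rfl hG hX) fun h => h.mono le_rfl hG hX

theorem NonplanarOn.map {G : SimpleGraph V} {H : SimpleGraph U} {X : Set V}
    (h : NonplanarOn G X) (φ : V → U) (hinj : Set.InjOn φ X)
    (hφ : ∀ u ∈ X, ∀ v ∈ X, G.Adj u v → H.Adj (φ u) (φ v)) : NonplanarOn H (φ '' X) :=
  h.imp (fun h => h.map φ hinj hφ) fun h => h.map φ hinj hφ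

theorem not_isApex_iff {G : SimpleGraph V} :
    ¬ IsApex G ↔ NonplanarOn G Set.univ ∧ ∀ v, NonplanarOn G {u | u ≠ v} := by
  simp only [IsApex, not_or, not_exists, not_isPlanar_induce]
  rw [not_isPlanar]

theorem IsKuratowski.nonplanarOn {G : SimpleGraph V} {H : G.Subgraph} (h : IsKuratowski H) :
    NonplanarOn G H.verts := by
  have : NonplanarOn H.coe Set.univ := h.imp (·.hasModelOn) (·.hasModelOn)
  simpa using this.map (H := G) Subtype.val Subtype.val_injective.injOn
    fun _ _ _ _ huv => H.coe_adj_sub _ _ huv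

/-- `K` has a minor model in `G` restricted to `X` with `a` and `b` in different branch sets. -/
def RootedModelOn (K : SimpleGraph W) (G : SimpleGraph V) (X : Set V) (a b : V) : Prop :=
  ∃ f i j, IsModel K G X f ∧ i ≠ j ∧ a ∈ f i ∧ b ∈ f j

theorem RootedModelOn.symm {K : SimpleGraph W} {G : SimpleGraph V} {X : Set V} {a b : V}
    (h : RootedModelOn K G X a b) : RootedModelOn K G X b a := by
  obtain ⟨f, i, j, hf, hij, ha, hb⟩ := h
  exact ⟨f, j, i, hf, hij.symm, hb, ha⟩

/-- If the part `Y` of a split branch set `Y ∪ Z` sees all neighbouring branch sets except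
possibly one, then the model can be rerouted. -/
theorem IsModel.reroute {K : SimpleGraph W} {G : SimpleGraph V} {X : Set V} {f : W → Set V}
    (hf : IsModel K G X f) {i j : W} {Y Z : Set V} {a b : V} (hY : ConnectedOn G Y)
    (hZ : ConnectedOn G Z) (ha : a ∈ Y) (hb : b ∈ Z) (hd : Disjoint Y Z) (hYZ : Y ∪ Z = f i)
    (hij : K.Adj i j)
    (hP : ∀ w, K.Adj i w → w ≠ j → ∃ u ∈ Y, ∃ v ∈ f w, G.Adj u v) :
    HasModelOn K G (X \ {b}) ∨ RootedModelOn K G X a b := by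
  classical
  have hYi : Y ⊆ f i := hYZ ▸ Set.subset_union_left
  have hZi : Z ⊆ f i := hYZ ▸ Set.subset_union_right
  have hdY : ∀ w, w ≠ i → Disjoint Y (f w) := fun w hw => (hf.disjoint hw.symm).mono_left hYi
  have hdZ : ∀ w, w ≠ i → Disjoint Z (f w) := fun w hw => (hf.disjoint hw.symm).mono_left hZi
  by_cases hj : ∃ u ∈ Y, ∃ v ∈ f j, G.Adj u v
  · left
    have hP' : ∀ w, K.Adj i w → ∃ u ∈ Y, ∃ v ∈ f w, G.Adj u v := fun w hw => by
      by_cases h : w = j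
      · exact h ▸ hj
      · exact hP w hw h
    have hbY : b ∉ Y := Set.disjoint_right.1 hd hb
    refine ⟨fun w => if w = i then Y else f w, fun w => ?_, fun w => ?_, fun w w' hw => ?_,
      fun w w' hw => ?_⟩
    · split_ifs with h
      exacts [hY, hf.connectedOn w]
    · split_ifs with h
      · exact fun x hx => ⟨hf.subset i (hYi hx), by rintro rfl; exact hbY hx⟩
      · exact fun x hx => ⟨hf.subset w hx, by rintro rfl; exact h (hf.eq_of_mem hx (hZi hb))⟩
    · split_ifs with h1 h2 h2
      · exact absurd (h1.trans h2.symm) hw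
      · exact hdY _ h2
      · exact (hdY _ h1).symm
      · exact hf.disjoint hw
    · split_ifs with h1 h2 h2
      · exact absurd (h1.trans h2.symm) hw.ne
      · exact hP' w' (h1 ▸ hw)
      · obtain ⟨u, hu, v, hv, huv⟩ := hP' w (h2 ▸ hw.symm)
        exact ⟨v, hv, u, hu, huv.symm⟩
      · exact hf.exists_adj hw
  · right
    have hjZ : ∃ u ∈ Z, ∃ v ∈ f j, G.Adj u v := by
      obtain ⟨u, hu, v, hv, huv⟩ := hf.exists_adj hij
      rw [← hYZ] at hu
      rcases hu with hu | hu
      · exact absurd ⟨u, hu, v, hv, huv⟩ hj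
      · exact ⟨u, hu, v, hv, huv⟩
    obtain ⟨y, hy, z, hz, hyz⟩ : ∃ y ∈ Y, ∃ z ∈ Z, G.Adj y z :=
      (hYZ ▸ hf.connectedOn i).exists_adj ⟨a, ha⟩ ⟨b, hb⟩ hd
    refine ⟨fun w => if w = i then Y else if w = j then Z ∪ f j else f w, i, j,
      ⟨fun w => ?_, fun w => ?_, fun w w' hw => ?_, ?_⟩, hij.ne, by simpa using ha,
      by simp [hij.ne', hb]⟩
    · split_ifs with h h'
      · exact hY
      · obtain ⟨u, hu, v, hv, huv⟩ := hjZ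
        exact hZ.union (hf.connectedOn j) hu hv huv
      · exact hf.connectedOn w
    · split_ifs with h h'
      · exact hYi.trans (hf.subset i)
      · exact Set.union_subset (hZi.trans (hf.subset i)) (hf.subset j)
      · exact hf.subset w
    · split_ifs with h1 h2 h3 h4 h5 h6 h7 h8
      · exact absurd (h1.trans h2.symm) hw
      · exact hd.union_right (hdY j hij.ne')
      · exact hdY _ h2
      · exact (hd.union_right (hdY j hij.ne')).symm
      · exact absurd (h4.trans h6.symm) hw
      · exact (hdZ _ h5).union_left (hf.disjoint (Ne.symm h6))
      · exact (hdY _ h1).symm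
      · exact ((hdZ _ h1).union_left (hf.disjoint (Ne.symm h4))).symm
      · exact hf.disjoint hw
    · have hsymm : ∀ w w', K.Adj w w' → (w = i ∨ (w ≠ i ∧ w' ≠ i)) →
          ∃ u ∈ (if w = i then Y else if w = j then Z ∪ f j else f w),
          ∃ v ∈ (if w' = i then Y else if w' = j then Z ∪ f j else f w'), G.Adj u v := by
        intro w w' hw hor
        rcases hor with rfl | ⟨h1, h2⟩
        · rw [if_pos rfl, if_neg hw.ne']
          split_ifs with h
          · exact ⟨y, hy, z, .inl hz, hyz⟩
          · exact hP w' hw h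
        · obtain ⟨u, hu, v, hv, huv⟩ := hf.exists_adj hw
          rw [if_neg h1, if_neg h2]
          refine ⟨u, ?_, v, ?_, huv⟩
          · split_ifs with h
            · exact .inr (h ▸ hu)
            · exact hu
          · split_ifs with h
            · exact .inr (h ▸ hv)
            · exact hv
      intro w w' hw
      by_cases h1 : w = i
      · exact hsymm w w' hw (.inl h1)
      by_cases h2 : w' = i
      · obtain ⟨u, hu, v, hv, huv⟩ := hsymm w' w hw.symm (.inl h2)
        exact ⟨v, hv, u, hu, huv.symm⟩
      · exact hsymm w w' hw (.inr ⟨h1, h2⟩)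

theorem K33_partition : ∀ (P : Fin 6 → Prop) (i : Fin 6), ∃ j, K33.Adj i j ∧
    ((∀ w, K33.Adj i w → w ≠ j → P w) ∨ ∀ w, K33.Adj i w → w ≠ j → ¬ P w) := by
  have key : ∀ i : Fin 6, ∃ x y z, K33.Adj i x ∧ K33.Adj i y ∧ K33.Adj i z ∧ x ≠ y ∧ y ≠ z ∧
      x ≠ z ∧ ∀ w, K33.Adj i w → w = x ∨ w = y ∨ w = z := by
    decide +kernel
  intro P i
  obtain ⟨x, y, z, hx, hy, hz, hxy, hyz, hxz, hall⟩ := key i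
  grind

theorem even_split_or (p q r s : Prop) :
    ((q ∧ r ∧ s) ∨ (p ∧ r ∧ s) ∨ (p ∧ q ∧ s) ∨ (p ∧ q ∧ r)) ∨
    ((¬ q ∧ ¬ r ∧ ¬ s) ∨ (¬ p ∧ ¬ r ∧ ¬ s) ∨ (¬ p ∧ ¬ q ∧ ¬ s) ∨ (¬ p ∧ ¬ q ∧ ¬ r)) ∨
    ((p ∧ q ∧ ¬ r ∧ ¬ s) ∨ (p ∧ r ∧ ¬ q ∧ ¬ s) ∨ (p ∧ s ∧ ¬ q ∧ ¬ r) ∨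
      (q ∧ r ∧ ¬ p ∧ ¬ s) ∨ (q ∧ s ∧ ¬ p ∧ ¬ r) ∨ (r ∧ s ∧ ¬ p ∧ ¬ q)) := by
  by_cases hp : p <;> by_cases hq : q <;> by_cases hr : r <;> by_cases hs : s <;>
    simp [hp, hq, hr, hs]

theorem K5_partition (P : Fin 5 → Prop) (i : Fin 5) :
    (∃ j, i ≠ j ∧ ((∀ w, i ≠ w → w ≠ j → P w) ∨ ∀ w, i ≠ w → w ≠ j → ¬ P w)) ∨
    ∃ x y z w, [i, x, y, z, w].Nodup ∧ P x ∧ P y ∧ ¬ P z ∧ ¬ P w := by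
  have key : ∀ i : Fin 5, ∃ x y z w, [i, x, y, z, w].Nodup ∧
      ∀ v, i ≠ v → v = x ∨ v = y ∨ v = z ∨ v = w := by
    decide +kernel
  obtain ⟨x, y, z, w, hn, hall⟩ := key i
  have hperm : ∀ l : List (Fin 5), l.Perm [x, y, z, w] → (i :: l).Nodup := fun l hl =>
    (hl.cons i).nodup_iff.2 hn
  have hi : i ≠ x ∧ i ≠ y ∧ i ≠ z ∧ i ≠ w := by simpa using (List.nodup_cons.1 hn).1
  have hleft : ∀ j, i ≠ j → ∀ P : Fin 5 → Prop, (x ≠ j → P x) → (y ≠ j → P y) → (z ≠ j → P z) →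
      (w ≠ j → P w) → ∀ v, i ≠ v → v ≠ j → P v := by
    rintro j - P hx hy hz hw v hv hvj
    rcases hall v hv with rfl | rfl | rfl | rfl
    exacts [hx hvj, hy hvj, hz hvj, hw hvj]
  have hmost : ∀ P : Fin 5 → Prop, (P y ∧ P z ∧ P w) ∨ (P x ∧ P z ∧ P w) ∨ (P x ∧ P y ∧ P w) ∨
      (P x ∧ P y ∧ P z) → ∃ j, i ≠ j ∧ ∀ w, i ≠ w → w ≠ j → P w := by
    rintro P (⟨h1, h2, h3⟩ | ⟨h1, h2, h3⟩ | ⟨h1, h2, h3⟩ | ⟨h1, h2, h3⟩)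
    · exact ⟨x, hi.1, hleft x hi.1 P (absurd rfl) (fun _ => h1) (fun _ => h2) fun _ => h3⟩
    · exact ⟨y, hi.2.1, hleft y hi.2.1 P (fun _ => h1) (absurd rfl) (fun _ => h2) fun _ => h3⟩
    · exact ⟨z, hi.2.2.1, hleft z hi.2.2.1 P (fun _ => h1) (fun _ => h2) (absurd rfl) fun _ => h3⟩
    · exact ⟨w, hi.2.2.2, hleft w hi.2.2.2 P (fun _ => h1) (fun _ => h2) (fun _ => h3) (absurd rfl)⟩
  rcases even_split_or (P x) (P y) (P z) (P w) with h | h | hcases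
  · obtain ⟨j, hj, h⟩ := hmost P h
    exact .inl ⟨j, hj, .inl h⟩
  · obtain ⟨j, hj, h⟩ := hmost (fun v => ¬ P v) h
    exact .inl ⟨j, hj, .inr h⟩
  right
  rcases hcases with h | h | h | h | h | h
  · exact ⟨x, y, z, w, hn, h⟩
  · exact ⟨x, z, y, w, hperm _ (.cons _ (.swap _ _ _)), h⟩
  · exact ⟨x, w, y, z, hperm _ (.cons _ ((List.Perm.swap _ _ _).trans (.cons _ (.swap _ _ _)))), h⟩
  · exact ⟨y, z, x, w, hperm _ ((List.Perm.cons _ (.swap _ _ _)).trans (.swap _ _ _)), h⟩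
  · exact ⟨y, w, x, z, hperm _ ((List.Perm.cons _ ((List.Perm.swap _ _ _).trans
      (.cons _ (.swap _ _ _)))).trans (.swap _ _ _)), h⟩
  · exact ⟨z, w, x, y, hperm _ (List.perm_append_comm (l₁ := [z, w])), h⟩

/-- A branch set of a `K₅` model splitting evenly among its neighbours gives a `K₃,₃` model. -/
theorem IsModel.K33_of_split {G : SimpleGraph V} {X : Set V} {f : Fin 5 → Set V}
    (hf : IsModel K5 G X f) {i x y z w : Fin 5} {Y Z : Set V} {a b : V} (hY : ConnectedOn G Y)
    (hZ : ConnectedOn G Z) (ha : a ∈ Y) (hb : b ∈ Z) (hd : Disjoint Y Z) (hYZ : Y ∪ Z = f i)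
    (hn : [i, x, y, z, w].Nodup) (hx : ∃ u ∈ Y, ∃ v ∈ f x, G.Adj u v)
    (hy : ∃ u ∈ Y, ∃ v ∈ f y, G.Adj u v) (hz : ∃ u ∈ Z, ∃ v ∈ f z, G.Adj u v)
    (hw : ∃ u ∈ Z, ∃ v ∈ f w, G.Adj u v) : RootedModelOn K33 G X a b := by
  have hYi : Y ⊆ f i := hYZ ▸ Set.subset_union_left
  have hZi : Z ⊆ f i := hYZ ▸ Set.subset_union_right
  have hdY : ∀ w, i ≠ w → Disjoint Y (f w) := fun w hw => (hf.disjoint hw).mono_left hYi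
  have hdZ : ∀ w, i ≠ w → Disjoint Z (f w) := fun w hw => (hf.disjoint hw).mono_left hZi
  have hYZa : ∃ y ∈ Y, ∃ z ∈ Z, G.Adj y z :=
    (hYZ ▸ hf.connectedOn i).exists_adj ⟨a, ha⟩ ⟨b, hb⟩ hd
  have hadj : ∀ {v v' : Fin 5}, v ≠ v' → ∃ s ∈ f v, ∃ t ∈ f v', G.Adj s t :=
    fun h => hf.exists_adj h
  have hsymm : ∀ {A B : Set V}, (∃ u ∈ A, ∃ v ∈ B, G.Adj u v) → ∃ u ∈ B, ∃ v ∈ A, G.Adj u v :=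
    fun ⟨u, hu, v, hv, h⟩ => ⟨v, hv, u, hu, h.symm⟩
  simp only [List.nodup_cons, List.mem_cons, not_or, List.not_mem_nil, not_false_eq_true,
    List.nodup_nil, and_true] at hn
  obtain ⟨⟨hix, hiy, hiz, hiw⟩, ⟨hxy, hxz, hxw⟩, ⟨hyz, hyw⟩, hzw⟩ := hn
  let g : Fin 6 → Set V := ![Y, f z, f w, Z, f x, f y]
  have hgd : ∀ k l, k < l → Disjoint (g k) (g l) := by
    intro k l hkl
    fin_cases k <;> fin_cases l <;> first | exact absurd hkl (by decide) | skip
    exacts [hdY _ hiz, hdY _ hiw, hd, hdY _ hix, hdY _ hiy, hf.disjoint hzw, (hdZ _ hiz).symm,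
      hf.disjoint (Ne.symm hxz), hf.disjoint (Ne.symm hyz), (hdZ _ hiw).symm, hf.disjoint (Ne.symm hxw),
      hf.disjoint (Ne.symm hyw), hdZ _ hix, hdZ _ hiy, hf.disjoint hxy]
  have hga : ∀ k l, k < l → K33.Adj k l → ∃ u ∈ g k, ∃ v ∈ g l, G.Adj u v := by
    intro k l hkl hadj'
    fin_cases k <;> fin_cases l <;>
      first | exact absurd hkl (by decide) | exact absurd hadj' (by decide) | skip
    exacts [hYZa, hx, hy, hsymm hz, hadj (Ne.symm hxz), hadj (Ne.symm hyz), hsymm hw, hadj (Ne.symm hxw),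
      hadj (Ne.symm hyw)]
  refine ⟨g, 0, 3, ⟨fun k => ?_, fun k => ?_, fun k l hkl => ?_, fun k l hkl => ?_⟩, by decide,
    ha, hb⟩
  · fin_cases k
    exacts [hY, hf.connectedOn z, hf.connectedOn w, hZ, hf.connectedOn x, hf.connectedOn y]
  · fin_cases k
    exacts [hYi.trans (hf.subset i), hf.subset z, hf.subset w, hZi.trans (hf.subset i),
      hf.subset x, hf.subset y]
  · rcases lt_or_gt_of_ne hkl with h | h
    exacts [hgd k l h, (hgd l k h).symm]
  · rcases lt_or_gt_of_ne hkl.ne with h | h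
    exacts [hga k l h hkl, hsymm (hga l k h hkl.symm)]

/-- If the nonplanarity of `X` depends on both `a` and `b`, then there is a Kuratowski model with
`a` and `b` in different branch sets. -/
theorem NonplanarOn.exists_rooted {G : SimpleGraph V} {X : Set V} {a b : V} (hab : a ≠ b)
    (h : NonplanarOn G X) (hXa : ¬ NonplanarOn G (X \ {a})) (hXb : ¬ NonplanarOn G (X \ {b})) :
    RootedModelOn K5 G X a b ∨ RootedModelOn K33 G X a b := by
  have cover : ∀ {n} {K : SimpleGraph (Fin n)} {f : Fin n → Set V} {c : V}, IsModel K G X f →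
      ¬ HasModelOn K G (X \ {c}) → ∃ w, c ∈ f w := by
    intro n K f c hf hc
    by_contra! hcon
    exact hc ⟨f, hf.connectedOn, fun w x hx => ⟨hf.subset w hx, by
      rintro rfl; exact hcon w hx⟩, hf.disjoint, hf.exists_adj⟩
  simp only [NonplanarOn, not_or] at hXa hXb
  rcases h with ⟨f, hf⟩ | ⟨f, hf⟩
  · obtain ⟨i, hi⟩ := cover hf hXa.1
    obtain ⟨j, hj⟩ := cover hf hXb.1
    by_cases hij : i = j
    · subst hij
      obtain ⟨Y, Z, hY, hZ, ha, hb, hd, hYZ⟩ := (hf.connectedOn i).exists_split hi hj hab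
      have hor : ∀ w, i ≠ w → (¬ ∃ u ∈ Y, ∃ v ∈ f w, G.Adj u v) →
          ∃ u ∈ Z, ∃ v ∈ f w, G.Adj u v := by
        intro w hw hno
        obtain ⟨u, hu, v, hv, huv⟩ := hf.exists_adj hw
        rw [← hYZ] at hu
        rcases hu with hu | hu
        · exact absurd ⟨u, hu, v, hv, huv⟩ hno
        · exact ⟨u, hu, v, hv, huv⟩
      rcases K5_partition (fun w => ∃ u ∈ Y, ∃ v ∈ f w, G.Adj u v) i with
        ⟨j, hj, hP | hP⟩ | ⟨x, y, z, w, hn, hx, hy, hz, hw⟩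
      · exact .inl ((hf.reroute hY hZ ha hb hd hYZ hj hP).resolve_left hXb.1)
      · exact .inl ((hf.reroute hZ hY hb ha hd.symm (by rwa [Set.union_comm]) hj
          fun w hw hwj => hor w hw (hP w hw hwj)).resolve_left hXa.1).symm
      · refine .inr (hf.K33_of_split hY hZ ha hb hd hYZ hn hx hy (hor z ?_ hz) (hor w ?_ hw)) <;>
        · rintro rfl
          simp at hn
    · exact .inl ⟨f, i, j, hf, hij, hi, hj⟩
  · obtain ⟨i, hi⟩ := cover hf hXa.2
    obtain ⟨j, hj⟩ := cover hf hXb.2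
    by_cases hij : i = j
    · subst hij
      obtain ⟨Y, Z, hY, hZ, ha, hb, hd, hYZ⟩ := (hf.connectedOn i).exists_split hi hj hab
      obtain ⟨j, hj, hP | hP⟩ := K33_partition (fun w => ∃ u ∈ Y, ∃ v ∈ f w, G.Adj u v) i
      · exact .inr ((hf.reroute hY hZ ha hb hd hYZ hj hP).resolve_left hXb.2)
      · refine .inr ((hf.reroute hZ hY hb ha hd.symm (by rwa [Set.union_comm]) hj
          fun w hw hwj => ?_).resolve_left hXa.2).symm
        obtain ⟨u, hu, v, hv, huv⟩ := hf.exists_adj hw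
        rw [← hYZ] at hu
        rcases hu with hu | hu
        · exact absurd ⟨u, hu, v, hv, huv⟩ (hP w hw hwj)
        · exact ⟨u, hu, v, hv, huv⟩
    · exact .inr ⟨f, i, j, hf, hij, hi, hj⟩

theorem K5_sup_edge (i j : Fin 5) : K5 ⊔ edge i j = K5 := top_sup_eq _

theorem exists_perm_K33e (i j : Fin 6) (hij : i ≠ j) (h : ¬ K33.Adj i j) :
    ∃ e : Equiv.Perm (Fin 6), ∀ x y, K33e.Adj (e x) (e y) ↔
      (K33.Adj x y ∨ (((x = i ∧ y = j) ∨ (x = j ∧ y = i)) ∧ x ≠ y)) := by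
  let flip : Equiv.Perm (Fin 6) := if i.val < 3 then 1 else Equiv.addRight 3
  let e₁ : Equiv.Perm (Fin 6) := flip.trans (Equiv.swap (flip i) 0)
  refine ⟨e₁.trans (Equiv.swap (e₁ j) 1), ?_⟩
  revert i j
  decide +kernel

theorem K33_sup_edge {i j : Fin 6} (hij : i ≠ j) :
    Nonempty (K33 ⊔ edge i j ≃g K33) ∨ Nonempty (K33 ⊔ edge i j ≃g K33e) := by
  by_cases h : K33.Adj i j
  · rw [sup_eq_left.2 ((edge_le_iff _).2 (.inr h))]
    exact .inl ⟨.refl⟩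
  · obtain ⟨e, he⟩ := exists_perm_K33e i j hij h
    exact .inr ⟨⟨e, by simp [he, edge_adj]⟩⟩

end Kuratowski

section Obstructions

variable {V W U : Type}

theorem IsModel.exists_iso [Finite V] {G : SimpleGraph V} {H : SimpleGraph W} {X : Set V}
    {f : W → Set V} (hf : IsModel H G X f) (e : H ≃g G) : ∃ g : H ≃g G, ∀ w, f w = {g w} := by
  have : Finite W := Finite.of_equiv V e.symm.toEquiv
  choose g hg using fun w => (hf.connectedOn w).1
  have hinj : Function.Injective g := fun w w' h => hf.eq_of_mem (hg w) (h ▸ hg w')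
  have hbij : Function.Bijective g := by
    have : Function.Bijective (e.symm ∘ g) :=
      Finite.injective_iff_bijective.1 (e.symm.injective.comp hinj)
    exact (Function.Bijective.of_comp_iff' e.symm.bijective g).1 this
  have hfg : ∀ w, f w = {g w} := by
    refine fun w => Set.eq_singleton_iff_unique_mem.2 ⟨hg w, fun x hx => ?_⟩
    obtain ⟨w', rfl⟩ := hbij.2 x
    rw [hf.eq_of_mem hx (hg w')]
  have hle : H ≤ G.comap g := by
    intro w w' hw
    obtain ⟨u, hu, v, hv, huv⟩ := hf.exists_adj hw
    rw [hfg, Set.mem_singleton_iff] at hu hv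
    rwa [comap_adj, ← hu, ← hv]
  let e' : G.comap g ≃g G := ⟨Equiv.ofBijective g hbij, Iff.rfl⟩
  have hcard : (G.comap g).edgeSet.ncard ≤ H.edgeSet.ncard := by
    rw [← Nat.card_coe_set_eq, ← Nat.card_coe_set_eq]
    exact (Nat.card_congr (Iso.mapEdgeSet (e'.trans e.symm))).le
  have heq : H = G.comap g :=
    edgeSet_injective (Set.eq_of_subset_of_ncard_le (edgeSet_mono hle) hcard)
  exact ⟨⟨Equiv.ofBijective g hbij, by intro v w; rw [heq]; rfl⟩, hfg⟩

/-- A model of a nonapex graph in an apex obstruction is an isomorphism. -/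
theorem IsApexObstruction.exists_iso [Finite V] {G : SimpleGraph V} (hG : IsApexObstruction G)
    {H : SimpleGraph W} (hH : ¬ IsApex H) {X : Set V} {f : W → Set V} (hf : IsModel H G X f) :
    ∃ g : H ≃g G, ∀ w, f w = {g w} := by
  by_contra hc
  refine hH (hG.2 W H hf.isMinorOf ⟨fun e => hc (hf.exists_iso e)⟩)

theorem connectedOn_of_vConn [Fintype V] {G : SimpleGraph V} (h : vConn G = 2) (s : Finset V)
    (hs : s.card < 2) : ConnectedOn G (s : Set V)ᶜ := by
  rw [connectedOn_iff]
  have hmem := Nat.sSup_mem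
    (s := {k : ℕ | ∀ s : Finset V, s.card < k → (G.induce ((↑s : Set V)ᶜ)).Connected})
    ⟨0, fun s hs => absurd hs (Nat.not_lt_zero _)⟩ ⟨Fintype.card V, fun k hk => by
      by_contra! hlt
      obtain ⟨x, hx⟩ := (hk Finset.univ hlt).nonempty
      exact hx (by simp)⟩
  change vConn G ∈ _ at hmem
  rw [h] at hmem
  exact hmem s hs

/-- A Kuratowski graph, seen through the properties used below. -/
structure IsKuratowskiLike (K : SimpleGraph W) : Prop where
  isRobust : IsRobust K
  nonplanarOn : NonplanarOn K Set.univ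

theorem isKuratowskiLike_K5 : IsKuratowskiLike K5 := ⟨isRobust_K5, .inl (hasModelOn_self _)⟩

theorem isKuratowskiLike_K33 : IsKuratowskiLike K33 := ⟨isRobust_K33, .inr (hasModelOn_self _)⟩

theorem NonplanarOn.nonempty {G : SimpleGraph V} {X : Set V} (h : NonplanarOn G X) :
    X.Nonempty := by
  rcases h with ⟨f, hf⟩ | ⟨f, hf⟩ <;> exact (hf.connectedOn 0).1.mono (hf.subset 0)

theorem NonplanarOn.exists_model {G : SimpleGraph V} {X : Set V} (h : NonplanarOn G X) :
    ∃ (n : ℕ) (K : SimpleGraph (Fin n)), IsKuratowskiLike K ∧ HasModelOn K G X :=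
  h.elim (fun h => ⟨5, K5, isKuratowskiLike_K5, h⟩) fun h => ⟨6, K33, isKuratowskiLike_K33, h⟩

theorem IsApexObstruction.not_disjoint_nonplanarOn [Finite V] {G : SimpleGraph V}
    (hG : IsApexObstruction G) (hc : ConnectedOn G Set.univ) {X Y : Set V} (hXY : Disjoint X Y)
    (hX : NonplanarOn G X) : ¬ NonplanarOn G Y := by
  intro hY
  obtain ⟨n, K, hK, f, hf⟩ := hX.exists_model
  obtain ⟨m, K', hK', f', hf'⟩ := hY.exists_model
  have hm : IsModel (K ⊕g K') G Set.univ (Sum.elim f f') := by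
    refine ⟨?_, fun _ => Set.subset_univ _, ?_, ?_⟩
    · rintro (w | w)
      exacts [hf.connectedOn w, hf'.connectedOn w]
    · rintro (w | w) (w' | w') h
      · exact hf.disjoint (by simpa using h)
      · exact hXY.mono (hf.subset w) (hf'.subset w')
      · exact (hXY.mono (hf.subset w') (hf'.subset w)).symm
      · exact hf'.disjoint (by simpa using h)
    · rintro (w | w) (w' | w') h
      · exact hf.exists_adj (by simpa using h)
      · simp at h
      · simp at h
      · exact hf'.exists_adj (by simpa using h)
  have hl : NonplanarOn (K ⊕g K') (Set.range Sum.inl) := by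
    simpa using hK.nonplanarOn.map (H := K ⊕g K') Sum.inl Sum.inl_injective.injOn (by simp)
  have hr : NonplanarOn (K ⊕g K') (Set.range Sum.inr) := by
    simpa using hK'.nonplanarOn.map (H := K ⊕g K') Sum.inr Sum.inr_injective.injOn (by simp)
  have hna : ¬ IsApex (K ⊕g K') := by
    refine not_isApex_iff.2 ⟨hl.mono le_rfl (Set.subset_univ _), ?_⟩
    rintro (v | v)
    · exact hr.mono le_rfl (by rintro _ ⟨x, rfl⟩; simp)
    · exact hl.mono le_rfl (by rintro _ ⟨x, rfl⟩; simp)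
  obtain ⟨e, -⟩ := hG.exists_iso hna hm
  have hcon := hc.image (H := K ⊕g K') e.symm fun u _ v _ huv => e.symm.map_adj_iff.2 huv
  rw [Set.image_univ_of_surjective e.symm.surjective] at hcon
  obtain ⟨x, -⟩ := hK.nonplanarOn.nonempty
  obtain ⟨y, -⟩ := hK'.nonplanarOn.nonempty
  obtain ⟨z, hz⟩ := hcon.2 (Set.range Sum.inl) ⟨_, trivial, x, rfl⟩ (by
    rintro _ - ⟨u, rfl⟩ (v | v) - huv
    · exact ⟨v, rfl⟩
    · simp at huv) (Set.mem_univ (Sum.inr y))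
  simp at hz

theorem NonplanarOn.of_link {G : SimpleGraph V} {X Q : Set V} {a b : V}
    (h : NonplanarOn (G ⊔ edge a b) X) (hQ : ConnectedOn G Q) (hd : Disjoint X Q)
    (haQ : ∃ x ∈ Q, G.Adj a x) (hbQ : ∃ x ∈ Q, G.Adj b x) : NonplanarOn G (X ∪ Q) :=
  h.imp (·.of_link hQ hd haQ hbQ) (·.of_link hQ hd haQ hbQ)

theorem NonplanarOn.of_sup_edge {G : SimpleGraph V} {X : Set V} {a b : V}
    (h : NonplanarOn (G ⊔ edge a b) X) (hX : a ∉ X ∨ b ∉ X) : NonplanarOn G X := by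
  simpa using h.map (H := G) id Function.injective_id.injOn fun u hu v hv huv => by
    rcases huv with huv | huv
    · exact huv
    · rw [edge_adj] at huv
      rcases huv with ⟨⟨rfl, rfl⟩ | ⟨rfl, rfl⟩, _⟩
      · exact absurd hX (by simp [hu, hv])
      · exact absurd hX (by simp [hu, hv])

theorem NonplanarOn.separate {G G₁ G₂ : SimpleGraph V} {A B : Set V} {a b : V}
    (h : NonplanarOn G (A ∪ {a, b} ∪ B)) (hAB : ∀ u ∈ A, ∀ v ∈ B, ¬ G.Adj u v)
    (hA : Disjoint A {a, b}) (hB : Disjoint B {a, b}) (hd : Disjoint A B) (h₁ : G ≤ G₁)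
    (h₂ : G ≤ G₂) (hl₁ : Linked G B a b → G₁.Adj a b) (hl₂ : Linked G A a b → G₂.Adj a b) :
    NonplanarOn G₁ (A ∪ {a, b}) ∨ NonplanarOn G₂ (B ∪ {a, b}) := by
  rcases h with h | h
  · exact (h.separate isRobust_K5 hAB hA hB hd h₁ h₂ hl₁ hl₂).imp .inl .inl
  · exact (h.separate isRobust_K33 hAB hA hB hd h₁ h₂ hl₁ hl₂).imp .inr .inr

theorem NonplanarOn.induce {G : SimpleGraph V} {X Y : Set V} (h : NonplanarOn G Y) (hYX : Y ⊆ X) :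
    NonplanarOn (G.induce X) (Subtype.val ⁻¹' Y) :=
  h.imp (·.induce hYX) (·.induce hYX)

/-- `{a, b}` separates the heavy side `C` from the remaining vertices `B`. -/
structure IsHeavySeparation (G : SimpleGraph V) (a b : V) (C B : Set V) : Prop where
  ne : a ≠ b
  disjoint_left : Disjoint C {a, b}
  disjoint_right : Disjoint B {a, b}
  disjoint : Disjoint C B
  cover : C ∪ {a, b} ∪ B = Set.univ
  not_adj : ∀ u ∈ C, ∀ v ∈ B, ¬ G.Adj u v
  nonplanarOn_b : NonplanarOn G (C ∪ {b})
  nonplanarOn_a : NonplanarOn G (C ∪ {a})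
  linked : Linked G B a b
  connectedOn : ConnectedOn G Set.univ

namespace IsHeavySeparation

variable {G : SimpleGraph V} {a b : V} {C B : Set V}

theorem a_notMem (h : IsHeavySeparation G a b C B) : a ∉ C :=
  fun ha => Set.disjoint_left.1 h.disjoint_left ha (.inl rfl)

theorem b_notMem (h : IsHeavySeparation G a b C B) : b ∉ C :=
  fun ha => Set.disjoint_left.1 h.disjoint_left ha (.inr rfl)

theorem compl_singleton (h : IsHeavySeparation G a b C B) {c : V} (hc : c ∈ C) :
    {u | u ≠ c} = C \ {c} ∪ {a, b} ∪ B := by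
  ext u
  constructor
  · intro hu
    rcases h.cover.ge (Set.mem_univ u) with (hC | hS) | hB
    exacts [.inl (.inl ⟨hC, hu⟩), .inl (.inr hS), .inr hB]
  · rintro ((hu | hu) | hu) rfl
    exacts [hu.2 rfl, Set.disjoint_left.1 h.disjoint_left hc hu,
      Set.disjoint_left.1 h.disjoint hc hu]

theorem separate (h : IsHeavySeparation G a b C B) (hG : ¬ IsApex G) {c : V} (hc : c ∈ C)
    {H : SimpleGraph V} (hGH : G ≤ H) (hl : Linked G (C \ {c}) a b → H.Adj a b) :
    NonplanarOn (G ⊔ edge a b) (C \ {c} ∪ {a, b}) ∨ NonplanarOn H (B ∪ {a, b}) := by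
  have hnp := (not_isApex_iff.1 hG).2 c
  rw [h.compl_singleton hc] at hnp
  exact hnp.separate (fun u hu => h.not_adj u hu.1) (h.disjoint_left.mono_left Set.sdiff_subset)
    h.disjoint_right (h.disjoint.mono_left Set.sdiff_subset) le_sup_left hGH
    (fun _ => .inr (by simp [edge_adj, h.ne])) hl

variable [Finite V]

theorem not_nonplanarOn (h : IsHeavySeparation G a b C B) (hG : IsApexObstruction G) {X : Set V}
    (hX : X ⊆ B ∪ {a, b}) (hab : a ∉ X ∨ b ∉ X) : ¬ NonplanarOn (G ⊔ edge a b) X := by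
  intro hnp
  have hnp := hnp.of_sup_edge hab
  have hCX : Disjoint C X := (h.disjoint.union_right h.disjoint_left).mono_right hX
  rcases hab with hab | hab
  · exact hG.not_disjoint_nonplanarOn h.connectedOn (hCX.union_left (by simpa using hab))
      h.nonplanarOn_a hnp
  · exact hG.not_disjoint_nonplanarOn h.connectedOn (hCX.union_left (by simpa using hab))
      h.nonplanarOn_b hnp

/-- The light side together with a virtual edge `ab` is nonplanar. -/
theorem nonplanarOn_light (h : IsHeavySeparation G a b C B) (hG : IsApexObstruction G) :
    NonplanarOn (G ⊔ edge a b) (B ∪ {a, b}) := by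
  by_contra hnot
  set P := (G ⊔ edge a b).induce (C ∪ {a, b})
  have hPG : HasModelOn P G Set.univ := by
    obtain ⟨Q, hQ, hQc, haQ, hbQ⟩ := h.linked
    have : HasModelOn P (G ⊔ edge a b) (C ∪ {a, b}) :=
      hasModelOn_iff.2 (hasModelOn_univ.1 (hasModelOn_self _))
    exact (this.of_link hQc ((h.disjoint.union_left h.disjoint_right.symm).mono_right hQ)
      haQ hbQ).mono le_rfl le_rfl (Set.subset_univ _)
  have hiso : IsEmpty (P ≃g G) := by
    refine ⟨fun e => ?_⟩
    have hsurj : Function.Surjective (Subtype.val ∘ e.symm : V → V) :=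
      Finite.injective_iff_surjective.1 (Subtype.val_injective.comp e.symm.injective)
    obtain ⟨Q, hQ, ⟨⟨x, hx⟩, -⟩, -⟩ := h.linked
    obtain ⟨y, rfl⟩ := hsurj x
    exact Set.disjoint_left.1 (h.disjoint.union_left h.disjoint_right.symm) (e.symm y).2 (hQ hx)
  have ha : NonplanarOn (G ⊔ edge a b) ((C ∪ {a, b}) \ {b}) := h.nonplanarOn_a.mono le_sup_left
    (by rintro x (hx | rfl)
        exacts [⟨.inl hx, by rintro rfl; exact h.b_notMem hx⟩, ⟨.inr (.inl rfl), h.ne⟩])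
  have hb : NonplanarOn (G ⊔ edge a b) ((C ∪ {a, b}) \ {a}) := h.nonplanarOn_b.mono le_sup_left
    (by rintro x (hx | rfl)
        exacts [⟨.inl hx, by rintro rfl; exact h.a_notMem hx⟩, ⟨.inr (.inr rfl), h.ne.symm⟩])
  have hdel : ∀ v (hv : v ∈ C ∪ {a, b}), NonplanarOn (G ⊔ edge a b) ((C ∪ {a, b}) \ {v}) →
      NonplanarOn P {u | u ≠ ⟨v, hv⟩} := by
    intro v hv hnp
    refine (hnp.induce Set.sdiff_subset).mono le_rfl ?_
    rintro u hu rfl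
    exact hu.2 rfl
  refine not_isApex_iff.2 ⟨(hdel a (.inr (.inl rfl)) hb).mono le_rfl (Set.subset_univ _), ?_⟩
    (hG.2 _ P (hasModelOn_univ.1 hPG) hiso)
  rintro ⟨v, hv⟩
  refine hdel v hv ?_
  rcases hv with hv | rfl | rfl
  · refine ((h.separate hG.1 hv (H := G ⊔ edge a b) le_sup_left
      fun _ => .inr (by simp [edge_adj, h.ne])).resolve_right hnot).mono le_rfl ?_
    rintro x (hx | hx)
    · exact ⟨.inl hx.1, hx.2⟩
    · refine ⟨.inr hx, ?_⟩
      rintro rfl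
      exact Set.disjoint_left.1 h.disjoint_left hv hx
  · exact hb
  · exact ha

end IsHeavySeparation

/-- The graph obtained from the subgraph of `G` induced by `C ∪ {a, b}` without the edge `ab`
and from `K` by identifying `a` with `i` and `b` with `j`. -/
def glue (G : SimpleGraph V) (C : Set V) (a b : V) (K : SimpleGraph W) (i j : W) :
    SimpleGraph (C ⊕ W) where
  Adj
    | .inl x, .inl y => G.Adj x y
    | .inl x, .inr k => (k = i ∧ G.Adj x a) ∨ (k = j ∧ G.Adj x b)
    | .inr k, .inl x => (k = i ∧ G.Adj x a) ∨ (k = j ∧ G.Adj x b)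
    | .inr k, .inr l => K.Adj k l
  symm := ⟨by
    rintro (x | k) (y | l) h
    exacts [G.adj_symm h, h, h, K.adj_symm h]⟩
  loopless := ⟨by
    rintro (x | k) h
    exacts [G.loopless.irrefl _ h, K.loopless.irrefl _ h]⟩

open Classical in
/-- The inclusion of `C ∪ {a, b}` into `glue G C a b K i j`. -/
noncomputable def toGlue (C : Set V) (a : V) (i j : W) (x : V) : C ⊕ W :=
  if h : x ∈ C then .inl ⟨x, h⟩ else if x = a then .inr i else .inr j

section Glue

variable {G : SimpleGraph V} {a b : V} {C B : Set V} {K : SimpleGraph W} {i j : W}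

theorem toGlue_of_mem {x : V} (hx : x ∈ C) : toGlue C a i j x = .inl ⟨x, hx⟩ := dif_pos hx

theorem toGlue_left (ha : a ∉ C) : toGlue C a i j a = .inr i := by
  rw [toGlue, dif_neg ha, if_pos rfl]

theorem toGlue_right (hb : b ∉ C) (hab : a ≠ b) : toGlue C a i j b = .inr j := by
  rw [toGlue, dif_neg hb, if_neg hab.symm]

theorem toGlue_injOn (ha : a ∉ C) (hb : b ∉ C) (hab : a ≠ b) (hij : i ≠ j) :
    Set.InjOn (toGlue C a i j) (C ∪ {a, b}) := by
  rintro x (hx | rfl | rfl) y (hy | rfl | rfl) h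
  all_goals
    simp only [toGlue_of_mem, toGlue_left, toGlue_right, *, not_false_eq_true, ne_eq] at h
    first | rfl | simp_all

theorem toGlue_adj (ha : a ∉ C) (hb : b ∉ C) (hab : a ≠ b) {x y : V} (hx : x ∈ C ∪ {a, b})
    (hy : y ∈ C ∪ {a, b}) (hxy : G.Adj x y) (h : x ∈ C ∨ y ∈ C) :
    (glue G C a b K i j).Adj (toGlue C a i j x) (toGlue C a i j y) := by
  have key : ∀ x y, x ∈ C → y ∈ C ∪ {a, b} → G.Adj x y →
      (glue G C a b K i j).Adj (toGlue C a i j x) (toGlue C a i j y) := by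
    clear hx hy hxy h
    rintro x y hx (hy | rfl | rfl) hxy
    · rw [toGlue_of_mem hx, toGlue_of_mem hy]
      exact hxy
    · rw [toGlue_of_mem hx, toGlue_left ha]
      exact .inl ⟨rfl, hxy⟩
    · rw [toGlue_of_mem hx, toGlue_right hb hab]
      exact .inr ⟨rfl, hxy⟩
  rcases h with h | h
  exacts [key x y h hy hxy, (key y x h hx hxy.symm).symm]

theorem IsRobust.connectedOn {K : SimpleGraph W} (hK : IsRobust K) (i j : W) :
    ConnectedOn K {k | k ≠ i ∧ k ≠ j} := by
  obtain ⟨x, hxi, hxj, -⟩ := hK.exists_neighbor i i j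
  refine ⟨⟨x, hxi, hxj⟩, ?_⟩
  rintro T ⟨y, hy, hyT⟩ hT z hz
  by_cases hyz : y = z
  · exact hyz ▸ hyT
  rcases hK.exists_common y z hyz with h | h
  · exact hT y hy hyT z hz h
  · obtain ⟨w, hwi, hwj, hyw, hwz⟩ := h i j
    exact hT w ⟨hwi, hwj⟩ (hT y hy hyT w ⟨hwi, hwj⟩ hyw) z hz hwz

/-- Replacing the light side by a Kuratowski graph, possibly without the edge `ij`, gives a
nonapex graph if deleting a vertex of the heavy side does not destroy nonplanarity. -/
theorem IsHeavySeparation.not_isApex_glue (h : IsHeavySeparation G a b C B) (hij : i ≠ j)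
    (hC : ∀ c : C, NonplanarOn (glue G C a b K i j) {u | u ≠ .inl c}) :
    ¬ IsApex (glue G C a b K i j) := by
  have hmap : ∀ x ∈ ({a, b} : Set V), NonplanarOn G (C ∪ {x}) →
      NonplanarOn (glue G C a b K i j) (toGlue C a i j '' (C ∪ {x})) := by
    intro x hx hnp
    have hsub : C ∪ {x} ⊆ C ∪ {a, b} := Set.union_subset_union_right _ (by simpa using hx)
    refine hnp.map _ ((toGlue_injOn h.a_notMem h.b_notMem h.ne hij).mono hsub) ?_
    intro u hu v hv huv
    refine toGlue_adj h.a_notMem h.b_notMem h.ne (hsub hu) (hsub hv) huv ?_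
    rcases hu with hu | rfl
    · exact .inl hu
    · exact .inr (hv.resolve_right fun hv => huv.ne hv.symm)
  have hall : ∀ v, NonplanarOn (glue G C a b K i j) {u | u ≠ v} := by
    rintro (c | k)
    · exact hC c
    · by_cases hk : k = i
      · refine (hmap b (.inr rfl) h.nonplanarOn_b).mono le_rfl ?_
        rintro _ ⟨x, hx | rfl, rfl⟩
        · simp [toGlue_of_mem hx]
        · simp [toGlue_right h.b_notMem h.ne, hk, hij.symm]
      · refine (hmap a (.inl rfl) h.nonplanarOn_a).mono le_rfl ?_
        rintro _ ⟨x, hx | rfl, rfl⟩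
        · simp [toGlue_of_mem hx]
        · simp [toGlue_left h.a_notMem, Ne.symm hk]
  exact not_isApex_iff.2 ⟨(hall (.inr i)).mono le_rfl (Set.subset_univ _), hall⟩

theorem IsHeavySeparation.isModel_glue (h : IsHeavySeparation G a b C B) {f : W → Set V}
    {H : SimpleGraph V} (hf : IsModel K H (B ∪ {a, b}) f) (ha : a ∈ f i) (hb : b ∈ f j)
    (hfc : ∀ w, ConnectedOn G (f w))
    {K' : SimpleGraph W} (hK' : ∀ k l, K'.Adj k l → ∃ u ∈ f k, ∃ v ∈ f l, G.Adj u v) :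
    IsModel (glue G C a b K' i j) G Set.univ (Sum.elim (fun x => {(x : V)}) f) := by
  have hd : ∀ (x : C) w, Disjoint {(x : V)} (f w) := fun x w =>
    (h.disjoint.union_right h.disjoint_left).mono (by simp) (hf.subset w)
  have hadj : ∀ (x : C) k, (k = i ∧ G.Adj x a) ∨ (k = j ∧ G.Adj x b) → ∃ v ∈ f k, G.Adj x v := by
    rintro x k (⟨rfl, hx⟩ | ⟨rfl, hx⟩)
    exacts [⟨a, ha, hx⟩, ⟨b, hb, hx⟩]
  refine ⟨?_, fun _ => Set.subset_univ _, ?_, ?_⟩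
  · rintro (x | w)
    exacts [connectedOn_singleton G _, hfc w]
  · rintro (x | w) (y | w') hne
    · simpa [Subtype.ext_iff] using hne
    · exact hd x w'
    · exact (hd y w).symm
    · exact hf.disjoint (by simpa using hne)
  · rintro (x | w) (y | w') hxy
    · exact ⟨x, rfl, y, rfl, hxy⟩
    · obtain ⟨v, hv, hxv⟩ := hadj x w' hxy
      exact ⟨x, rfl, v, hv, hxv⟩
    · obtain ⟨v, hv, hxv⟩ := hadj y w hxy
      exact ⟨v, hv, y, rfl, hxv.symm⟩
    · exact hK' w w' hxy

/-- If gluing a Kuratowski graph `K`, possibly without the edge `ij`, to the heavy side gives a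
nonapex graph, then the augmented light side is `K` with the edge `ij`. -/
theorem IsHeavySeparation.nonempty_iso [Finite V] (h : IsHeavySeparation G a b C B)
    (hG : IsApexObstruction G) (hK : IsRobust K) {f : W → Set V} {H : SimpleGraph V}
    (hf : IsModel K H (B ∪ {a, b}) f) (hij : i ≠ j) (ha : a ∈ f i) (hb : b ∈ f j)
    (hfc : ∀ w, ConnectedOn G (f w)) {K' : SimpleGraph W}
    (hK' : ∀ k l, K'.Adj k l → ∃ u ∈ f k, ∃ v ∈ f l, G.Adj u v)
    (hK'le : K' ≤ K) (hKle : K ≤ K' ⊔ edge i j)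
    (hC : ∀ c : C, NonplanarOn (glue G C a b K' i j) {u | u ≠ .inl c})
    {L : Set V} (hL : IsCompOf G {a, b} L) (hLB : L ⊆ B) :
    Nonempty (augment G {a, b} L ≃g K ⊔ edge i j) := by
  obtain ⟨g, hg⟩ := hG.exists_iso (h.not_isApex_glue hij hC) (h.isModel_glue hf ha hb hfc hK')
  have hgr : ∀ k, f k = {g (.inr k)} := fun k => hg (.inr k)
  have hgi : g (.inr i) = a := by simpa [hgr, eq_comm] using ha
  have hgj : g (.inr j) = b := by simpa [hgr, eq_comm] using hb
  have hgB : ∀ k, k ≠ i → k ≠ j → g (.inr k) ∈ B := by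
    intro k hki hkj
    rcases hf.subset k (by rw [hgr]; rfl) with hk | hk | hk
    · exact hk
    · exact absurd (Sum.inr_injective (g.injective (hk.trans hgi.symm))) hki
    · exact absurd (Sum.inr_injective (g.injective (hk.trans hgj.symm))) hkj
  have hsurj : ∀ x ∈ B ∪ {a, b}, ∃ k, g (.inr k) = x := by
    intro x hx
    obtain ⟨c | k, hw⟩ := g.surjective x
    · have hcx : (c : V) = x := by
        have := hg (.inl c)
        rw [hw] at this
        simpa using this
      exact absurd hx (Set.disjoint_left.1 (h.disjoint.union_right h.disjoint_left) (hcx ▸ c.2))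
    · exact ⟨k, hw⟩
  have hBL : B ⊆ L := by
    have hQ : ConnectedOn K' {k | k ≠ i ∧ k ≠ j} :=
      ((hK.connectedOn i j).mono hKle).of_sup_edge (.inl fun hi => hi.1 rfl)
    have hBc := hQ.image (H := G) (fun k => g (.inr k)) fun u _ v _ huv => g.map_adj_iff.2 huv
    obtain ⟨x, hx⟩ := hL.1
    have himage : ∀ y ∈ B, y ∈ (fun k => g (.inr k)) '' {k | k ≠ i ∧ k ≠ j} := by
      intro y hy
      obtain ⟨k, rfl⟩ := hsurj y (.inl hy)
      refine ⟨k, ⟨?_, ?_⟩, rfl⟩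
      · rintro rfl
        exact Set.disjoint_left.1 h.disjoint_right hy (.inl hgi)
      · rintro rfl
        exact Set.disjoint_left.1 h.disjoint_right hy (.inr hgj)
    refine fun y hy => hBc.2 L ⟨x, himage x (hLB hx), hx⟩ ?_ (himage y hy)
    rintro u - huL _ ⟨k, hk, rfl⟩ huv
    exact hL.2.2.2 u huL _ (Set.disjoint_left.1 h.disjoint_right (hgB k hk.1 hk.2)) huv
  obtain rfl : L = B := hLB.antisymm hBL
  have hmem : ∀ k, g (.inr k) ∈ L ∪ {a, b} := fun k => hf.subset k (by rw [hgr]; rfl)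
  let φ : W → ↥(L ∪ {a, b}) := fun k => ⟨g (.inr k), hmem k⟩
  have hφ : Function.Bijective φ := by
    constructor
    · intro k l hkl
      exact Sum.inr_injective (g.injective (congrArg Subtype.val hkl))
    · rintro ⟨x, hx⟩
      obtain ⟨k, rfl⟩ := hsurj x hx
      exact ⟨k, rfl⟩
  have hS : ∀ k, g (.inr k) ∈ ({a, b} : Set V) ↔ k = i ∨ k = j := by
    intro k
    constructor
    · rintro (hk | hk)
      exacts [.inl (Sum.inr_injective (g.injective (hk.trans hgi.symm))),
        .inr (Sum.inr_injective (g.injective (hk.trans hgj.symm)))]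
    · rintro (rfl | rfl)
      exacts [.inl hgi, .inr hgj]
  have hKeq : K ⊔ edge i j = K' ⊔ edge i j :=
    le_antisymm (sup_le hKle le_sup_right) (sup_le_sup_right hK'le _)
  rw [hKeq]
  refine ⟨(⟨Equiv.ofBijective φ hφ, ?_⟩ : K' ⊔ edge i j ≃g augment G {a, b} L).symm⟩
  intro k l
  have hadj : G.Adj (g (.inr k)) (g (.inr l)) ↔ K'.Adj k l := g.map_adj_iff
  have hne : φ k ≠ φ l ↔ k ≠ l := hφ.1.ne_iff
  simp only [augment, Equiv.ofBijective_apply, fromRel_adj, hne, SimpleGraph.sup_adj, edge_adj]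
  simp only [φ, hadj, hS, G.adj_comm (g (.inr l))]
  have := fun h : K'.Adj k l => h.ne
  grind

end Glue

/-- The augmented light side is a Kuratowski graph, possibly with one additional edge. -/
theorem IsHeavySeparation.light_iso [Finite V] {G : SimpleGraph V} {a b : V} {C B : Set V}
    (h : IsHeavySeparation G a b C B) (hG : IsApexObstruction G) {K : SimpleGraph W}
    (hK : IsKuratowskiLike K) {L : Set V} (hL : IsCompOf G {a, b} L) (hLB : L ⊆ B)
    (hr : RootedModelOn K G (B ∪ {a, b}) a b ∨
      ¬ NonplanarOn G (B ∪ {a, b}) ∧ RootedModelOn K (G ⊔ edge a b) (B ∪ {a, b}) a b) :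
    ∃ i j, i ≠ j ∧ Nonempty (augment G {a, b} L ≃g K ⊔ edge i j) := by
  rcases hr with ⟨f, i, j, hf, hij, ha, hb⟩ | ⟨hnp, f, i, j, hf, hij, ha, hb⟩
  · refine ⟨i, j, hij, h.nonempty_iso hG hK.isRobust hf hij ha hb hf.connectedOn (K' := K)
      (fun k l hkl => hf.exists_adj hkl) le_rfl le_sup_left (fun c => ?_) hL hLB⟩
    refine (hK.nonplanarOn.map (H := glue G C a b K i j) Sum.inr Sum.inr_injective.injOn
      fun _ _ _ _ huv => huv).mono le_rfl ?_
    rintro _ ⟨x, -, rfl⟩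
    simp
  · have hab : ¬ G.Adj a b := by
      intro hab
      rw [sup_eq_left.2 ((edge_le_iff _).2 (.inr hab))] at hf
      refine hnp ?_
      have := h.nonplanarOn_light hG
      rwa [sup_eq_left.2 ((edge_le_iff _).2 (.inr hab))] at this
    set K' := K.deleteEdges {s(i, j)}
    have hKle : K ≤ K' ⊔ edge i j := by
      intro k l hkl
      by_cases hs : s(k, l) = s(i, j)
      · right
        rw [edge_adj]
        exact ⟨by simpa using hs, hkl.ne⟩
      · left
        simpa [K', deleteEdges_adj, hkl] using hs
    have hadj : ∀ k l, K'.Adj k l → ∃ u ∈ f k, ∃ v ∈ f l, G.Adj u v := by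
      intro k l hkl
      rw [deleteEdges_adj] at hkl
      obtain ⟨u, hu, v, hv, huv⟩ := hf.exists_adj hkl.1
      refine ⟨u, hu, v, hv, huv.resolve_right fun he => hkl.2 ?_⟩
      rw [edge_adj] at he
      rcases he with ⟨⟨rfl, rfl⟩ | ⟨rfl, rfl⟩, _⟩
      · rw [hf.eq_of_mem hu ha, hf.eq_of_mem hv hb]
        rfl
      · rw [hf.eq_of_mem hu hb, hf.eq_of_mem hv ha]
        exact Sym2.eq_swap
    have hfc : ∀ w, ConnectedOn G (f w) := fun w => (hf.connectedOn w).of_sup_edge (by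
      by_contra! hc
      exact hij ((hf.eq_of_mem ha hc.1).trans (hf.eq_of_mem hc.2 hb)))
    refine ⟨i, j, hij, h.nonempty_iso hG hK.isRobust hf hij ha hb hfc hadj
      (K.deleteEdges_le _) hKle (fun ⟨c, hc⟩ => ?_) hL hLB⟩
    set D := glue G C a b K' i j
    have hinl : ∀ {X : Set V}, X ⊆ C → ConnectedOn G X →
        ConnectedOn D (toGlue C a i j '' X) := fun hX hXc => hXc.image _ fun u hu v hv huv =>
      toGlue_adj h.a_notMem h.b_notMem h.ne (.inl (hX hu)) (.inl (hX hv)) huv (.inl (hX hu))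
    by_cases hlink : Linked G (C \ {c}) a b
    · obtain ⟨Q, hQ, hQc, ⟨x, hx, hax⟩, y, hy, hby⟩ := hlink
      have hQC : Q ⊆ C := hQ.trans Set.sdiff_subset
      have hnpK : NonplanarOn (D ⊔ edge (.inr i) (.inr j)) (Sum.inr '' Set.univ) := by
        refine hK.nonplanarOn.map Sum.inr Sum.inr_injective.injOn fun u _ v _ huv => ?_
        rcases hKle huv with huv | huv
        · exact .inl huv
        · right
          simpa [edge_adj] using huv
      refine (hnpK.of_link (hinl hQC hQc) ?_ ⟨_, ⟨x, hx, rfl⟩, ?_⟩ ⟨_, ⟨y, hy, rfl⟩, ?_⟩).mono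
        le_rfl ?_
      · rw [Set.disjoint_left]
        rintro _ ⟨k, -, rfl⟩ ⟨z, hz, hzk⟩
        simp [toGlue_of_mem (hQC hz)] at hzk
      · rw [toGlue_of_mem (hQC hx)]
        exact .inl ⟨rfl, hax.symm⟩
      · rw [toGlue_of_mem (hQC hy)]
        exact .inr ⟨rfl, hby.symm⟩
      · rintro _ (⟨k, -, rfl⟩ | ⟨z, hz, rfl⟩)
        · simp
        · have : z ≠ c := (hQ hz).2
          simpa [toGlue_of_mem (hQC hz)] using this
    · have hheavy := (h.separate hG.1 hc le_rfl fun hl => absurd hl hlink).resolve_right hnp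
      have hsub : C \ {c} ∪ {a, b} ⊆ C ∪ {a, b} :=
        Set.union_subset_union_left _ Set.sdiff_subset
      have hnpD : NonplanarOn (D ⊔ edge (.inr i) (.inr j))
          (toGlue C a i j '' (C \ {c} ∪ {a, b})) := by
        refine hheavy.map _ ((toGlue_injOn h.a_notMem h.b_notMem h.ne hij).mono hsub) ?_
        intro u hu v hv huv
        by_cases huvC : u ∈ C ∨ v ∈ C
        · rcases huv with huv | huv
          · exact .inl (toGlue_adj h.a_notMem h.b_notMem h.ne (hsub hu) (hsub hv) huv huvC)
          · rw [edge_adj] at huv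
            rcases huv with ⟨⟨rfl, rfl⟩ | ⟨rfl, rfl⟩, _⟩ <;>
              simp [h.a_notMem, h.b_notMem] at huvC
        · rw [not_or] at huvC
          right
          rcases (hsub hu).resolve_left huvC.1 with rfl | rfl <;>
          rcases (hsub hv).resolve_left huvC.2 with rfl | rfl
          · exact absurd rfl huv.ne
          · rw [toGlue_left h.a_notMem, toGlue_right h.b_notMem h.ne]
            simp [edge_adj, hij]
          · rw [toGlue_left h.a_notMem, toGlue_right h.b_notMem h.ne]
            simp [edge_adj, hij.symm]
          · exact absurd rfl huv.ne
      have hQ : ConnectedOn K' {k | k ≠ i ∧ k ≠ j} :=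
        ((hK.isRobust.connectedOn i j).mono hKle).of_sup_edge (.inl fun hi => hi.1 rfl)
      have hnb : ∀ w, ∃ x, (x ≠ i ∧ x ≠ j) ∧ K'.Adj w x := by
        intro w
        obtain ⟨x, hxi, hxj, hwx⟩ := hK.isRobust.exists_neighbor w i j
        refine ⟨x, ⟨hxi, hxj⟩, (hKle hwx).resolve_right fun he => ?_⟩
        rw [edge_adj] at he
        rcases he with ⟨⟨-, h⟩ | ⟨-, h⟩, -⟩
        exacts [hxj h, hxi h]
      obtain ⟨x, hx, hix⟩ := hnb i
      obtain ⟨y, hy, hjy⟩ := hnb j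
      refine (hnpD.of_link (hQ.image (H := D) Sum.inr fun _ _ _ _ huv => huv) ?_
        ⟨_, ⟨x, hx, rfl⟩, hix⟩ ⟨_, ⟨y, hy, rfl⟩, hjy⟩).mono le_rfl ?_
      · rw [Set.disjoint_left]
        rintro _ ⟨z, hz | rfl | rfl, rfl⟩ ⟨k, hk, hkz⟩
        · simp [toGlue_of_mem hz.1] at hkz
        · rw [toGlue_left h.a_notMem] at hkz
          exact hk.1 (Sum.inr_injective hkz)
        · rw [toGlue_right h.b_notMem h.ne] at hkz
          exact hk.2 (Sum.inr_injective hkz)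
      · rintro _ (⟨z, hz | rfl | rfl, rfl⟩ | ⟨k, -, rfl⟩)
        · have : z ≠ c := hz.2
          simpa [toGlue_of_mem hz.1] using this
        · simp [toGlue_left h.a_notMem]
        · simp [toGlue_right h.b_notMem h.ne]
        · simp

theorem IsCompOf.exists_adj {G : SimpleGraph V} {a b c : V} {L : Set V}
    (hL : IsCompOf G {a, b} L) (hc : ConnectedOn G {b}ᶜ) (hcL : c ∉ L) (hcb : c ≠ b) :
    ∃ x ∈ L, G.Adj a x := by
  by_contra! hno
  obtain ⟨x, hx⟩ := hL.1
  have hbL : ∀ x ∈ L, x ≠ b := by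
    rintro x hx rfl
    exact Set.disjoint_left.1 hL.2.1 hx (.inr rfl)
  refine hcL (hc.2 L ⟨x, hbL x hx, hx⟩ ?_ hcb)
  intro u _ huL v hv huv
  refine hL.2.2.2 u huL v ?_ huv
  rintro (rfl | rfl)
  · exact hno u huL huv.symm
  · exact hv rfl

theorem IsCompOf.disjoint {G : SimpleGraph V} {S C L : Set V} (hC : IsCompOf G S C)
    (hL : IsCompOf G S L) (hne : L ≠ C) : Disjoint C L := by
  have key : ∀ {C L : Set V}, IsCompOf G S C → IsCompOf G S L → (C ∩ L).Nonempty → C ⊆ L := by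
    rintro C L hC hL ⟨x, hxC, hxL⟩
    exact (connectedOn_iff.2 hC.2.2.1).2 L ⟨x, hxC, hxL⟩ fun u _ huL v hv huv =>
      hL.2.2.2 u huL v (Set.disjoint_left.1 hC.2.1 hv) huv
  rw [Set.disjoint_iff_inter_eq_empty, ← Set.not_nonempty_iff_eq_empty]
  exact fun hx => hne ((key hL hC (by rwa [Set.inter_comm])).antisymm (key hC hL hx))

theorem IsHeavyComp.isHeavySeparation [Fintype V] {G : SimpleGraph V} {a b : V} {C L : Set V}
    (hk : vConn G = 2) (hab : a ≠ b) (hC : IsHeavyComp G a b C) (hL : IsCompOf G {a, b} L)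
    (hne : L ≠ C) : IsHeavySeparation G a b C (C ∪ {a, b})ᶜ := by
  obtain ⟨hC, ⟨Ha, ⟨hHa, haHa⟩, hHaC⟩, Hb, ⟨hHb, hbHb⟩, hHbC⟩ := hC
  have hd := hC.disjoint hL hne
  have hdel : ∀ x, ConnectedOn G {x}ᶜ := fun x => by
    simpa using connectedOn_of_vConn hk {x} (by simp)
  obtain ⟨c, hc⟩ := hC.1
  have hcL : c ∉ L := Set.disjoint_left.1 hd hc
  have hcS := Set.disjoint_left.1 hC.2.1 hc
  exact
    { ne := hab
      disjoint_left := hC.2.1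
      disjoint_right := disjoint_compl_left.mono_right Set.subset_union_right
      disjoint := disjoint_compl_right.mono_left Set.subset_union_left
      cover := Set.union_compl_self _
      not_adj := fun u hu v hv huv =>
        hv (.inl (hC.2.2.2 u hu v (fun hvS => hv (.inr hvS)) huv))
      nonplanarOn_b := hHa.nonplanarOn.mono le_rfl fun x hx => by
        rcases hHaC hx with h | rfl | h
        exacts [.inl h, absurd hx haHa, .inr h]
      nonplanarOn_a := hHb.nonplanarOn.mono le_rfl fun x hx => by
        rcases hHbC hx with h | h | rfl
        exacts [.inl h, .inr h, absurd hx hbHb]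
      linked := ⟨L, fun x hx => by
          rintro (h | h)
          exacts [Set.disjoint_left.1 hd h hx, Set.disjoint_left.1 hL.2.1 hx h],
        connectedOn_iff.2 hL.2.2.1,
        hL.exists_adj (hdel b) hcL fun h => hcS (.inr h),
        (Set.pair_comm a b ▸ hL).exists_adj (hdel a) hcL fun h => hcS (.inl h)⟩
      connectedOn := by simpa using connectedOn_of_vConn hk ∅ (by simp) }

end Obstructions

/-- For any basic 2-cut of an apex obstruction of connectivity two, the augmentation of
the light component is isomorphic to `K₅`, `K_{3,3}`, or `K_{3,3}+e`. -/
theorem light_component_structure {V : Type} [Fintype V] (G : SimpleGraph V)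
    (hG : IsApexObstruction G) (hk : vConn G = 2) (a b : V) (C : Set V)
    (hbasic : IsBasic2Cut G a b C)
    (L : Set V) (hL : IsCompOf G {a, b} L) (hne : L ≠ C) :
    Nonempty (augment G {a, b} L ≃g K5) ∨ Nonempty (augment G {a, b} L ≃g K33) ∨
      Nonempty (augment G {a, b} L ≃g K33e) := by
  have hab : a ≠ b := by
    rintro rfl
    have := hbasic.1.1
    simp at this
  have h := hbasic.2.1.isHeavySeparation hk hab hL hne
  have hLB : L ⊆ (C ∪ {a, b})ᶜ := fun x hx => by
    rintro (hxC | hxS)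
    · exact Set.disjoint_left.1 (hbasic.2.1.1.disjoint hL hne) hxC hx
    · exact Set.disjoint_left.1 hL.2.1 hx hxS
  have hnot : ∀ c ∈ ({a, b} : Set V),
      ¬ NonplanarOn (G ⊔ edge a b) (((C ∪ {a, b})ᶜ ∪ {a, b}) \ {c}) := by
    rintro c (rfl | rfl)
    · exact h.not_nonplanarOn hG Set.sdiff_subset (.inl fun hx => hx.2 rfl)
    · exact h.not_nonplanarOn hG Set.sdiff_subset (.inr fun hx => hx.2 rfl)
  have ha := hnot a (.inl rfl)
  have hb := hnot b (.inr rfl)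
  have h5 := h.light_iso hG isKuratowskiLike_K5 hL hLB
  have h33 := h.light_iso hG isKuratowskiLike_K33 hL hLB
  have hiso : (∃ i j, i ≠ j ∧ Nonempty (augment G {a, b} L ≃g K5 ⊔ edge i j)) ∨
      ∃ i j, i ≠ j ∧ Nonempty (augment G {a, b} L ≃g K33 ⊔ edge i j) := by
    by_cases hnp : NonplanarOn G ((C ∪ {a, b})ᶜ ∪ {a, b})
    · exact (hnp.exists_rooted hab (fun hx => ha (hx.mono le_sup_left subset_rfl))
        fun hx => hb (hx.mono le_sup_left subset_rfl)).imp (fun hr => h5 (.inl hr))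
        fun hr => h33 (.inl hr)
    · exact ((h.nonplanarOn_light hG).exists_rooted hab ha hb).imp
        (fun hr => h5 (.inr ⟨hnp, hr⟩)) fun hr => h33 (.inr ⟨hnp, hr⟩)
  rcases hiso with ⟨i, j, -, ⟨e⟩⟩ | ⟨i, j, hij, ⟨e⟩⟩
  · rw [K5_sup_edge] at e
    exact .inl ⟨e⟩
  · rcases K33_sup_edge hij with ⟨⟨e'⟩⟩ | ⟨⟨e'⟩⟩
    · exact .inr (.inl ⟨e.trans e'⟩)
    · exact .inr (.inr ⟨e.trans e'⟩)
end
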